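/- arXiv:2604.13394 — 11 statements merged into one kernel-verified Lean document; each statement's English description precedes it below -/
import Mathlib

section
/- Let N ≥ 1 and let a : {0,1,…,N} × {0,1,…,N} → ℝ be nonnegative weights with a(i,i) = 0. Define the matrix H ∈ ℝ^{N×N} (indexed by i,j ∈ {1,…,N}) by H(i,i) = Σ_{j=1}^{N} a(i,j) + a(i,0) and H(i,j) = −a(i,j) for i ≠ j. Suppose that for every node i ∈ {1,…,N} there is a directed path from node 0 to node i in the directed graph whose edge set consists of the pairs (u,w) with a(w,u) > 0 (i.e., node 0 is the root of a spanning tree). Then every eigenvalue of H, i.e., every root in ℂ of the characteristic polynomial of H, has strictly positive real part. -/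
/-- If the directed graph encoded by the nonnegative adjacency weights
`a` (with zero diagonal) contains a spanning tree rooted at node `0`, then every
eigenvalue (root of the characteristic polynomial over `ℂ`) of the matrix `H`
has strictly positive real part. -/
theorem stmt_0 (N : ℕ) (hN : 1 ≤ N) (a : Fin (N + 1) → Fin (N + 1) → ℝ)
    (ha_nonneg : ∀ i j, 0 ≤ a i j) (ha_diag : ∀ i, a i i = 0)
    (H : Matrix (Fin N) (Fin N) ℝ)
    (hH : ∀ i j : Fin N, H i j =
      if i = j then (∑ l : Fin N, a i.succ l.succ) + a i.succ 0
      else -(a i.succ j.succ))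
    (hreach : ∀ i : Fin N,
      Relation.TransGen (fun u w : Fin (N + 1) => 0 < a w u) 0 i.succ) :
    ∀ μ : ℂ, (Matrix.charpoly (H.map ((↑) : ℝ → ℂ))).IsRoot μ → 0 < μ.re := by
  intro μ hμ
  by_contra hneg
  push Not at hneg
  rw [Polynomial.IsRoot, Matrix.eval_charpoly] at hμ
  obtain ⟨v, hv0, hv⟩ := Matrix.exists_mulVec_eq_zero_iff.mpr hμ
  have hrow : ∀ i : Fin N,
      ((((∑ l : Fin N, a i.succ l.succ) + a i.succ 0 : ℝ) : ℂ) - μ) * v i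
        = ∑ j : Fin N, (a i.succ j.succ : ℂ) * v j := by
    intro i
    have h1 := congrFun hv i
    rw [Matrix.sub_mulVec, Pi.sub_apply, Pi.zero_apply] at h1
    have h2 : (Matrix.scalar (Fin N) μ).mulVec v i = μ * v i := by
      simp [Matrix.scalar_apply, Matrix.mulVec_diagonal]
    have h3 : (H.map ((↑) : ℝ → ℂ)).mulVec v i
        = ((((∑ l : Fin N, a i.succ l.succ) + a i.succ 0 : ℝ) : ℂ)) * v i
          - ∑ j : Fin N, (a i.succ j.succ : ℂ) * v j := by
      have h4 : ∀ j : Fin N, (H i j : ℂ) * v j =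
          (if i = j then (((∑ l : Fin N, a i.succ l.succ) + a i.succ 0 : ℝ) : ℂ) * v j else 0)
            - (a i.succ j.succ : ℂ) * v j := by
        intro j
        rw [hH]
        by_cases h : i = j
        · subst h
          rw [if_pos rfl, if_pos rfl, ha_diag]
          simp
        · rw [if_neg h, if_neg h]
          push_cast
          ring
      simp only [Matrix.mulVec, dotProduct, Matrix.map_apply]
      rw [Finset.sum_congr rfl (fun j _ => h4 j), Finset.sum_sub_distrib,
        Finset.sum_ite_eq, if_pos (Finset.mem_univ i)]
    rw [h2, h3] at h1
    linear_combination -h1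
  haveI : Nonempty (Fin N) := ⟨⟨0, hN⟩⟩
  obtain ⟨k, hk⟩ := Finite.exists_max (fun i => ‖v i‖)
  have hkpos : 0 < ‖v k‖ := by
    obtain ⟨j, hj⟩ := Function.ne_iff.mp hv0
    exact lt_of_lt_of_le (norm_pos_iff.mpr hj) (hk j)
  let b : Fin (N + 1) → ℝ := Fin.cons 0 (fun i => ‖v i‖)
  have hb0 : b 0 = 0 := rfl
  have hbs : ∀ i : Fin N, b i.succ = ‖v i‖ := fun i => rfl
  have hble : ∀ u, b u ≤ ‖v k‖ := by
    intro u
    refine Fin.cases ?_ (fun i => ?_) u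
    · rw [hb0]; exact hkpos.le
    · rw [hbs]; exact hk i
  have hstep : ∀ u w, 0 < a w u → b w = ‖v k‖ → b u = ‖v k‖ := by
    intro u w
    refine Fin.cases ?_ (fun i => ?_) w
    · intro _ h
      rw [hb0] at h
      exact absurd h hkpos.ne
    · intro hau hbi
      rw [hbs] at hbi
      have hn := congrArg norm (hrow i)
      rw [norm_mul, hbi] at hn
      have hup : ‖∑ j : Fin N, (a i.succ j.succ : ℂ) * v j‖
          ≤ ∑ j : Fin N, a i.succ j.succ * ‖v j‖ := by
        refine (norm_sum_le _ _).trans (le_of_eq ?_)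
        refine Finset.sum_congr rfl (fun j _ => ?_)
        rw [norm_mul, Complex.norm_real, Real.norm_of_nonneg (ha_nonneg _ _)]
      have hlow : (∑ l : Fin N, a i.succ l.succ) + a i.succ 0 ≤
          ‖(((∑ l : Fin N, a i.succ l.succ) + a i.succ 0 : ℝ) : ℂ) - μ‖ := by
        refine le_trans ?_ (Complex.re_le_norm _)
        rw [Complex.sub_re, Complex.ofReal_re]
        linarith
      have hmul := mul_le_mul_of_nonneg_right hlow hkpos.le
      have hsum : ∑ u, a i.succ u * (‖v k‖ - b u) ≤ 0 := by
        rw [Fin.sum_univ_succ, hb0]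
        simp only [hbs, mul_sub, Finset.sum_sub_distrib, ← Finset.sum_mul]
        linarith
      have hnn : ∀ u ∈ Finset.univ, 0 ≤ a i.succ u * (‖v k‖ - b u) := fun u _ =>
        mul_nonneg (ha_nonneg _ _) (sub_nonneg.mpr (hble u))
      have hz := (Finset.sum_eq_zero_iff_of_nonneg hnn).mp
        (le_antisymm hsum (Finset.sum_nonneg hnn)) u (Finset.mem_univ u)
      rcases mul_eq_zero.mp hz with h | h
      · exact absurd h hau.ne'
      · linarith
  have hall : ∀ w, Relation.TransGen (fun u w : Fin (N + 1) => 0 < a w u) 0 w →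
      b w = ‖v k‖ → b 0 = ‖v k‖ := by
    intro w hw
    induction hw with
    | single h => exact hstep _ _ h
    | tail _ h ih => exact fun hb => ih (hstep _ _ h hb)
  have hfin := hall _ (hreach k) (hbs k)
  rw [hb0] at hfin
  exact hkpos.ne hfin
end

section
/- Let N ≥ 1 and let a : {0,1,…,N} × {0,1,…,N} → ℝ be nonnegative weights with a(i,i) = 0. Define the matrix H ∈ ℝ^{N×N} (indexed by i,j ∈ {1,…,N}) by H(i,i) = Σ_{j=1}^{N} a(i,j) + a(i,0) and H(i,j) = −a(i,j) for i ≠ j. Suppose that for every node i ∈ {1,…,N} there is a directed path from node 0 to node i in the directed graph whose edge set consists of the pairs (u,w) with a(w,u) > 0. Then there exist positive real numbers k₁,…,k_N such that, with K = diag(k₁,…,k_N), the symmetric matrix HᵀK + KH − 2I_N is positive semidefinite. -/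
open Matrix

theorem aux_mulVec (N : ℕ) (a : Fin (N + 1) → Fin (N + 1) → ℝ)
    (ha_diag : ∀ i, a i i = 0)
    (H : Matrix (Fin N) (Fin N) ℝ)
    (hH : ∀ i j : Fin N, H i j =
      if i = j then (∑ l : Fin N, a i.succ l.succ) + a i.succ 0
      else -(a i.succ j.succ)) (v : Fin N → ℝ) (i : Fin N) :
    (H *ᵥ v) i = a i.succ 0 * v i + ∑ j, a i.succ j.succ * (v i - v j) := by
  have h1 : ∀ j, H i j * v j = (if i = j then ((∑ l : Fin N, a i.succ l.succ) + a i.succ 0) * v i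
      else 0) - a i.succ j.succ * v j := by
    intro j
    rw [hH]
    by_cases h : i = j
    · subst h
      simp [ha_diag]
    · simp [h]
  simp only [Matrix.mulVec, dotProduct, h1, Finset.sum_sub_distrib, mul_sub, Finset.sum_ite_eq,
    Finset.mem_univ, if_true, Finset.sum_mul, add_mul]
  ring

theorem aux_min (N : ℕ) (a : Fin (N + 1) → Fin (N + 1) → ℝ)
    (ha_nonneg : ∀ i j, 0 ≤ a i j) (v : Fin N → ℝ)
    (hreach : ∀ i : Fin N,
      Relation.TransGen (fun u w : Fin (N + 1) => 0 < a w u) 0 i.succ)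
    (hv : ∀ i : Fin N, 0 ≤ a i.succ 0 * v i + ∑ j, a i.succ j.succ * (v i - v j)) :
    ∀ i, 0 ≤ v i := by
  set V : Fin (N + 1) → ℝ := Fin.cons 0 v with hV
  have hV0 : V 0 = 0 := by simp [hV]
  have hVs : ∀ i : Fin N, V i.succ = v i := by intro i; simp [hV]
  have hsum : ∀ i : Fin N, 0 ≤ ∑ j, a i.succ j * (V i.succ - V j) := by
    intro i
    rw [Fin.sum_univ_succ]
    simp only [hV0, hVs, sub_zero]
    exact hv i
  obtain ⟨m, hm⟩ := Finite.exists_min V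
  by_contra! hcon
  obtain ⟨i0, hi0⟩ := hcon
  have hmneg : V m < 0 := lt_of_le_of_lt (hm i0.succ) (by rw [hVs]; exact hi0)
  have step : ∀ u w : Fin (N + 1), V m < V u → 0 < a w u → V m < V w := by
    intro u w hu hw
    rcases Fin.eq_zero_or_eq_succ w with h | ⟨i, h⟩
    · rw [h, hV0]; exact hmneg
    · subst h
      refine lt_of_le_of_ne (hm _) fun he => ?_
      have hlt : ∑ j, a i.succ j * (V i.succ - V j) < ∑ j : Fin (N + 1), (0 : ℝ) := by
        apply Finset.sum_lt_sum
        · intro j _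
          exact mul_nonpos_of_nonneg_of_nonpos (ha_nonneg _ _) (by linarith [hm j])
        · exact ⟨u, Finset.mem_univ _, mul_neg_of_pos_of_neg hw (by linarith)⟩
      have := hsum i
      simp only [Finset.sum_const_zero] at hlt
      linarith
  have hall : ∀ w, Relation.TransGen (fun u w : Fin (N + 1) => 0 < a w u) 0 w → V m < V w := by
    intro w hw
    induction hw with
    | single h => exact step _ _ (by rw [hV0]; exact hmneg) h
    | tail _ h ih => exact step _ _ ih h
  rcases Fin.eq_zero_or_eq_succ m with h | ⟨i, h⟩
  · rw [h, hV0] at hmneg; exact lt_irrefl _ hmneg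
  · have := hall _ (hreach i)
    rw [← h] at this
    exact lt_irrefl _ this


/-- If the directed graph encoded by the nonnegative adjacency weights
`a` (with zero diagonal) contains a spanning tree rooted at node `0`, then there
exist positive constants `k i` such that, with `K = diagonal k`, the symmetric
matrix `Hᵀ K + K H - 2 I` is positive semidefinite. -/
theorem stmt_1 (N : ℕ) (hN : 1 ≤ N) (a : Fin (N + 1) → Fin (N + 1) → ℝ)
    (ha_nonneg : ∀ i j, 0 ≤ a i j) (ha_diag : ∀ i, a i i = 0)
    (H : Matrix (Fin N) (Fin N) ℝ)
    (hH : ∀ i j : Fin N, H i j =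
      if i = j then (∑ l : Fin N, a i.succ l.succ) + a i.succ 0
      else -(a i.succ j.succ))
    (hreach : ∀ i : Fin N,
      Relation.TransGen (fun u w : Fin (N + 1) => 0 < a w u) 0 i.succ) :
    ∃ k : Fin N → ℝ, (∀ i, 0 < k i) ∧
      (Hᵀ * Matrix.diagonal k + Matrix.diagonal k * H
        - (2 : ℝ) • (1 : Matrix (Fin N) (Fin N) ℝ)).PosSemidef := by


  have hmv := aux_mulVec N a ha_diag H hH
  have hmin : ∀ v : Fin N → ℝ, (∀ i, 0 ≤ (H *ᵥ v) i) → ∀ i, 0 ≤ v i := by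
    intro v hv
    exact aux_min N a ha_nonneg v hreach (fun i => by rw [← hmv]; exact hv i)
  have hinj : Function.Injective H.mulVec := by
    intro v w hvw
    have hvw : H *ᵥ v = H *ᵥ w := hvw
    have h1 := hmin (v - w) (by intro i; rw [Matrix.mulVec_sub, hvw]; simp)
    have h2 := hmin (w - v) (by intro i; rw [Matrix.mulVec_sub, hvw]; simp)
    funext i
    have h1 := h1 i
    have h2 := h2 i
    simp only [Pi.sub_apply] at h1 h2
    linarith
  have hunit : IsUnit H := Matrix.mulVec_injective_iff_isUnit.1 hinj
  have hdet : IsUnit H.det := (Matrix.isUnit_iff_isUnit_det H).1 hunit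
  have hinv : ∀ i j, 0 ≤ H⁻¹ i j := by
    intro i j
    have := hmin (H⁻¹ *ᵥ Pi.single j 1) (by
      intro l
      rw [Matrix.mulVec_mulVec, Matrix.mul_nonsing_inv _ hdet, Matrix.one_mulVec]
      by_cases h : l = j
      · subst h; simp
      · simp [h]) i
    simpa using this
  obtain ⟨k, hk0, hk⟩ : ∃ k : Fin N → ℝ, (∀ i, 0 ≤ k i) ∧ k ᵥ* H = fun _ => 2 := by
    refine ⟨(fun _ => 2) ᵥ* H⁻¹, ?_, ?_⟩
    · intro i
      simp only [Matrix.vecMul, dotProduct]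
      exact Finset.sum_nonneg fun j _ => mul_nonneg (by norm_num) (hinv _ _)
    · rw [Matrix.vecMul_vecMul, Matrix.nonsing_inv_mul _ hdet, Matrix.vecMul_one]
  refine ⟨k, ?_, ?_⟩
  · intro i
    refine lt_of_le_of_ne (hk0 i) fun he => ?_
    have h2 := congrFun hk i
    have h3 : (k ᵥ* H) i ≤ 0 := by
      simp only [Matrix.vecMul, dotProduct]
      refine Finset.sum_nonpos fun j _ => ?_
      by_cases h : j = i
      · subst h; simp [← he]
      · rw [hH, if_neg h]
        nlinarith [mul_nonneg (hk0 j) (ha_nonneg j.succ i.succ)]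
    rw [h2] at h3
    norm_num at h3
  · refine Matrix.PosSemidef.of_dotProduct_mulVec_nonneg ?_ ?_
    · rw [Matrix.IsHermitian, Matrix.conjTranspose_eq_transpose_of_trivial]
      simp [Matrix.transpose_mul, add_comm]
    · intro z
      have hsq : ∑ i, k i * (H *ᵥ fun j => z j ^ 2) i = ∑ i, 2 * z i ^ 2 := by
        have := Matrix.dotProduct_mulVec k H (fun j => z j ^ 2)
        rw [hk] at this
        exact this
      have hq : star z ⬝ᵥ ((Hᵀ * Matrix.diagonal k + Matrix.diagonal k * H
          - (2 : ℝ) • (1 : Matrix (Fin N) (Fin N) ℝ)) *ᵥ z)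
          = ∑ i, k i * (2 * z i * (H *ᵥ z) i) - ∑ i, 2 * z i ^ 2 := by
        have e1 : z ⬝ᵥ ((Matrix.diagonal k * H) *ᵥ z) = ∑ i, k i * (z i * (H *ᵥ z) i) := by
          rw [← Matrix.mulVec_mulVec]
          simp only [dotProduct, Matrix.mulVec_diagonal]
          exact Finset.sum_congr rfl fun i _ => by ring
        have e2 : z ⬝ᵥ ((Hᵀ * Matrix.diagonal k) *ᵥ z) = z ⬝ᵥ ((Matrix.diagonal k * H) *ᵥ z) := by
          have : (Hᵀ * Matrix.diagonal k) = (Matrix.diagonal k * H)ᵀ := by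
            simp [Matrix.transpose_mul]
          rw [this, Matrix.mulVec_transpose, dotProduct_comm, Matrix.dotProduct_mulVec]
        rw [star_trivial, Matrix.sub_mulVec, Matrix.add_mulVec, dotProduct_sub, dotProduct_add,
          e2, e1, ← Finset.sum_add_distrib, Matrix.smul_mulVec, Matrix.one_mulVec]
        congr 1
        · exact Finset.sum_congr rfl fun i _ => by ring
        · simp only [dotProduct, Pi.smul_apply, smul_eq_mul]
          exact Finset.sum_congr rfl fun i _ => by ring
      rw [hq, ← hsq, sub_nonneg]
      refine Finset.sum_le_sum fun i _ => mul_le_mul_of_nonneg_left ?_ (hk0 i)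
      rw [hmv, hmv, mul_add, Finset.mul_sum]
      refine add_le_add ?_ (Finset.sum_le_sum fun j _ => ?_)
      · nlinarith [mul_nonneg (ha_nonneg i.succ 0) (sq_nonneg (z i))]
      · nlinarith [mul_nonneg (ha_nonneg i.succ j.succ) (sq_nonneg (z i - z j))]
end

section
/- Let N, q ≥ 1, let 0 < α < 1 < β, let μ₁, μ₂, μ₃ > 0, let k₁,…,k_N be reals with 0 < k_i ≤ k_M for all i, and let ς₁,…,ς_N ∈ ℝ^q. Define V = Σ_{i=1}^N k_i( (μ₁/2)Σ_{j=1}^q ς_{ij}² + (μ₂/(α+1))Σ_{j=1}^q |ς_{ij}|^{α+1} + (μ₃/(β+1))Σ_{j=1}^q |ς_{ij}|^{β+1} ) and s = Σ_{i=1}^N Σ_{j=1}^q ς_{ij}². Then V ≤ c₂(s^β + s^α + 3s), where c₂ = max{ μ₁k_M/2, (μ₂k_M/(α+1))(Nq)^{(1−α)/2}, μ₃k_M/(β+1) }. -/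
theorem aux_concave {ι : Type*} [Fintype ι] (y : ι → ℝ) (hy : ∀ i, 0 ≤ y i) (p : ℝ)
    (hp0 : 0 < p) (hp1 : p ≤ 1) :
    ∑ i, y i ^ p ≤ (Fintype.card ι : ℝ) ^ (1 - p) * (∑ i, y i) ^ p := by
  have h := Real.rpow_sum_le_const_mul_sum_rpow (s := Finset.univ) (f := fun i => y i ^ p)
    (p := 1 / p) (by rw [le_div_iff₀ hp0]; linarith)
  have e1 : ∀ i, |y i ^ p| = y i ^ p := fun i => abs_of_nonneg (Real.rpow_nonneg (hy i) p)
  have e2 : ∀ i, (y i ^ p) ^ (1 / p) = y i := fun i => by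
    rw [← Real.rpow_mul (hy i), mul_one_div_cancel hp0.ne', Real.rpow_one]
  simp only [e1, e2, Finset.card_univ] at h
  have hS : 0 ≤ ∑ i, y i ^ p := Finset.sum_nonneg fun i _ => Real.rpow_nonneg (hy i) p
  have hs : 0 ≤ ∑ i, y i := Finset.sum_nonneg fun i _ => hy i
  have h2 := Real.rpow_le_rpow (Real.rpow_nonneg hS _) h hp0.le
  rw [← Real.rpow_mul hS, one_div_mul_cancel hp0.ne', Real.rpow_one,
    Real.mul_rpow (by positivity) hs, ← Real.rpow_mul (by positivity)] at h2
  have e3 : (1 / p - 1) * p = 1 - p := by field_simp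
  rwa [e3] at h2

theorem aux_convex {ι : Type*} [Fintype ι] (y : ι → ℝ) (hy : ∀ i, 0 ≤ y i) (p : ℝ)
    (hp1 : 1 < p) :
    ∑ i, y i ^ p ≤ (∑ i, y i) ^ p := by
  have hs : 0 ≤ ∑ i, y i := Finset.sum_nonneg fun i _ => hy i
  have e : ∀ x : ℝ, 0 ≤ x → x ^ p = x * x ^ (p - 1) := fun x hx => by
    rw [← Real.rpow_one_add' hx (by linarith)]; congr 1; ring
  rw [e _ hs, Finset.sum_mul]
  refine Finset.sum_le_sum fun i _ => ?_
  rw [e _ (hy i)]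
  refine mul_le_mul_of_nonneg_left (Real.rpow_le_rpow (hy i) ?_ (by linarith)) (hy i)
  exact Finset.single_le_sum (fun j _ => hy j) (Finset.mem_univ i)

theorem aux_interp (s a p b : ℝ) (hs : 0 ≤ s) (ha : 0 < a) (h1 : a ≤ p) (h2 : p ≤ b) :
    s ^ p ≤ s ^ a + s ^ b := by
  have := Real.rpow_nonneg hs a
  have := Real.rpow_nonneg hs b
  rcases le_total s 1 with h | h
  · rcases hs.eq_or_lt with h0 | h0
    · subst h0
      rw [Real.zero_rpow (by linarith)]; linarith
    · have := Real.rpow_le_rpow_of_exponent_ge h0 h h1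
      linarith
  · have := Real.rpow_le_rpow_of_exponent_le h h2
    linarith

theorem aux_abs (x r : ℝ) : |x| ^ (r + 1) = (x ^ 2) ^ ((r + 1) / 2) := by
  rw [← sq_abs x, ← Real.rpow_natCast, ← Real.rpow_mul (abs_nonneg x)]
  congr 1; push_cast; ring

/-- the Lyapunov function `V` is bounded above by
`c₂ (s^β + s^α + 3 s)` where `s` is the squared norm of the stacked vector. -/
theorem stmt_8 (N q : ℕ) (hN : 1 ≤ N) (hq : 1 ≤ q)
    (α β μ₁ μ₂ μ₃ kM : ℝ) (hα0 : 0 < α) (hα1 : α < 1) (hβ : 1 < β)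
    (hμ₁ : 0 < μ₁) (hμ₂ : 0 < μ₂) (hμ₃ : 0 < μ₃)
    (k : Fin N → ℝ) (hk : ∀ i, 0 < k i) (hkM : ∀ i, k i ≤ kM)
    (ς : Fin N → Fin q → ℝ) :
    (∑ i, k i * ((μ₁ / 2) * ∑ j, (ς i j) ^ 2
        + (μ₂ / (α + 1)) * ∑ j, |ς i j| ^ (α + 1)
        + (μ₃ / (β + 1)) * ∑ j, |ς i j| ^ (β + 1))) ≤
      max (max (μ₁ * kM / 2)
            ((μ₂ * kM / (α + 1)) * ((N * q : ℕ) : ℝ) ^ ((1 - α) / 2)))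
          (μ₃ * kM / (β + 1)) *
        ((∑ i, ∑ j, (ς i j) ^ 2 : ℝ) ^ β + (∑ i, ∑ j, (ς i j) ^ 2 : ℝ) ^ α
          + 3 * (∑ i, ∑ j, (ς i j) ^ 2)) := by
  have hA := aux_concave (fun z : Fin N × Fin q => ς z.1 z.2 ^ 2) (fun _ => sq_nonneg _)
    ((α + 1) / 2) (by linarith) (by linarith)
  have hB := aux_convex (fun z : Fin N × Fin q => ς z.1 z.2 ^ 2) (fun _ => sq_nonneg _)
    ((β + 1) / 2) (by linarith)
  simp only [← aux_abs, Fintype.sum_prod_type, Fintype.card_prod, Fintype.card_fin] at hA hB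
  have hs : 0 ≤ ∑ i, ∑ j, (ς i j) ^ 2 :=
    Finset.sum_nonneg fun i _ => Finset.sum_nonneg fun j _ => sq_nonneg _
  rw [show 1 - (α + 1) / 2 = (1 - α) / 2 by ring] at hA
  have hkM0 : 0 < kM := (hk ⟨0, hN⟩).trans_le (hkM _)
  have hV : (∑ i, k i * ((μ₁ / 2) * ∑ j, (ς i j) ^ 2
        + (μ₂ / (α + 1)) * ∑ j, |ς i j| ^ (α + 1)
        + (μ₃ / (β + 1)) * ∑ j, |ς i j| ^ (β + 1))) ≤
      (μ₁ * kM / 2) * (∑ i, ∑ j, (ς i j) ^ 2)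
        + (μ₂ * kM / (α + 1)) * (∑ i, ∑ j, |ς i j| ^ (α + 1))
        + (μ₃ * kM / (β + 1)) * (∑ i, ∑ j, |ς i j| ^ (β + 1)) := by
    rw [Finset.mul_sum, Finset.mul_sum, Finset.mul_sum, ← Finset.sum_add_distrib,
      ← Finset.sum_add_distrib]
    refine Finset.sum_le_sum fun i _ => ?_
    refine (mul_le_mul_of_nonneg_right (hkM i) (by positivity)).trans (le_of_eq ?_)
    ring
  have hC := aux_interp _ α ((α + 1) / 2) 1 hs hα0 (by linarith) (by linarith)
  have hD := aux_interp _ 1 ((β + 1) / 2) β hs one_pos (by linarith) (by linarith)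
  rw [Real.rpow_one] at hC hD
  refine hV.trans ?_
  generalize (∑ i, ∑ j, (ς i j) ^ 2) = s at *
  set c := max (max (μ₁ * kM / 2)
            ((μ₂ * kM / (α + 1)) * ((N * q : ℕ) : ℝ) ^ ((1 - α) / 2)))
          (μ₃ * kM / (β + 1)) with hc
  have c1 : μ₁ * kM / 2 ≤ c := (le_max_left _ _).trans (le_max_left _ _)
  have c2 : (μ₂ * kM / (α + 1)) * ((N * q : ℕ) : ℝ) ^ ((1 - α) / 2) ≤ c :=
    (le_max_right _ _).trans (le_max_left _ _)
  have c3 : μ₃ * kM / (β + 1) ≤ c := le_max_right _ _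
  have hc0 : 0 ≤ c := le_trans (by positivity) c1
  have t1 := mul_le_mul_of_nonneg_right c1 hs
  have t2 := mul_le_mul_of_nonneg_left hA (show 0 ≤ μ₂ * kM / (α + 1) by positivity)
  rw [← mul_assoc] at t2
  have t2' := mul_le_mul c2 hC (by positivity) hc0
  have t3 := mul_le_mul c3 (hB.trans hD) (by positivity) hc0
  linarith
end

section
/- Let N, q ≥ 1, let α, β be reals with 0 < α < 1 < 1/α < β, let μ₁, μ₂, μ₃ > 0, let k₁,…,k_N be reals with 0 < k_i ≤ k_M for all i, and let ς₁,…,ς_N ∈ ℝ^q. Define V = Σ_{i=1}^N k_i( (μ₁/2)Σ_{j=1}^q ς_{ij}² + (μ₂/(α+1))Σ_{j=1}^q |ς_{ij}|^{α+1} + (μ₃/(β+1))Σ_{j=1}^q |ς_{ij}|^{β+1} ) and s = Σ_{i=1}^N Σ_{j=1}^q ς_{ij}². Then V^{2β/(β+1)} ≤ c₃(3s^β + s + s^α), where c₃ = (3Nq)^{(β−1)/(β+1)} (max{ μ₁k_M/2, μ₂k_M/(α+1), μ₃k_M/(β+1) })^{2β/(β+1)}. -/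
lemma aux_super {ι : Type*} (t : Finset ι) (y : ι → ℝ) (hy : ∀ i, 0 ≤ y i) (r : ℝ) (hr : 1 ≤ r) :
    ∑ i ∈ t, (y i) ^ r ≤ (∑ i ∈ t, y i) ^ r := by
  have hs : 0 ≤ ∑ i ∈ t, y i := Finset.sum_nonneg fun i _ => hy i
  have key : ∀ z : ℝ, 0 ≤ z → z ^ r = z * z ^ (r - 1) := by
    intro z hz
    have := Real.rpow_one_add' hz (y := r - 1) (by linarith)
    rw [← this]; congr 1; ring
  rw [key _ hs, Finset.sum_mul]
  refine Finset.sum_le_sum fun i hi => ?_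
  rw [key _ (hy i)]
  exact mul_le_mul_of_nonneg_left (Real.rpow_le_rpow (hy i)
    (Finset.single_le_sum (fun j _ => hy j) hi) (by linarith)) (hy i)

lemma aux_between (s a r b : ℝ) (hs : 0 ≤ s) (ha : 0 < a) (har : a ≤ r) (hrb : r ≤ b) :
    s ^ r ≤ s ^ a + s ^ b := by
  have h1 := Real.rpow_nonneg hs a
  have h2 := Real.rpow_nonneg hs b
  rcases hs.eq_or_lt with h | h
  · rw [← h, Real.zero_rpow (by linarith : r ≠ 0)]; subst h; linarith
  rcases le_total s 1 with h3 | h3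
  · have := Real.rpow_le_rpow_of_exponent_ge h h3 har
    linarith
  · have := Real.rpow_le_rpow_of_exponent_le h3 hrb
    linarith

lemma aux_pow (x a : ℝ) : (|x| ^ a) = (x ^ 2) ^ (a / 2) := by
  rw [← sq_abs, ← Real.rpow_natCast, ← Real.rpow_mul (abs_nonneg x)]
  congr 1; push_cast; ring

/-- the bound `V^(2β/(β+1)) ≤ c₃ (3 s^β + s + s^α)` for the
Lyapunov function `V`, where `s` is the squared norm of the stacked vector. -/
theorem stmt_9 (N q : ℕ) (hN : 1 ≤ N) (hq : 1 ≤ q)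
    (α β μ₁ μ₂ μ₃ kM : ℝ) (hα0 : 0 < α) (hα1 : α < 1) (hαβ : 1 / α < β)
    (hμ₁ : 0 < μ₁) (hμ₂ : 0 < μ₂) (hμ₃ : 0 < μ₃)
    (k : Fin N → ℝ) (hk : ∀ i, 0 < k i) (hkM : ∀ i, k i ≤ kM)
    (ς : Fin N → Fin q → ℝ) :
    (∑ i, k i * ((μ₁ / 2) * ∑ j, (ς i j) ^ 2
        + (μ₂ / (α + 1)) * ∑ j, |ς i j| ^ (α + 1)
        + (μ₃ / (β + 1)) * ∑ j, |ς i j| ^ (β + 1)) : ℝ) ^ (2 * β / (β + 1)) ≤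
      ((3 * N * q : ℕ) : ℝ) ^ ((β - 1) / (β + 1)) *
          (max (max (μ₁ * kM / 2) (μ₂ * kM / (α + 1)))
            (μ₃ * kM / (β + 1)) : ℝ) ^ (2 * β / (β + 1)) *
        (3 * (∑ i, ∑ j, (ς i j) ^ 2 : ℝ) ^ β + (∑ i, ∑ j, (ς i j) ^ 2)
          + (∑ i, ∑ j, (ς i j) ^ 2 : ℝ) ^ α) := by
  have hβ : 1 < β := lt_trans ((one_lt_div hα0).2 hα1) hαβ
  have hαβ' : 1 < α * β := by rw [div_lt_iff₀ hα0] at hαβ; linarith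
  set M := max (max (μ₁ * kM / 2) (μ₂ * kM / (α + 1))) (μ₃ * kM / (β + 1)) with hM
  set s := ∑ i, ∑ j, (ς i j) ^ 2 with hs
  set p := 2 * β / (β + 1) with hp
  have hp1 : (β - 1) / (β + 1) = p - 1 := by rw [hp]; field_simp; ring
  have hp_one : 1 ≤ p := by rw [hp, le_div_iff₀ (by linarith)]; linarith
  have hs0 : 0 ≤ s := Finset.sum_nonneg fun i _ => Finset.sum_nonneg fun j _ => sq_nonneg _
  have hM1 : μ₁ * kM / 2 ≤ M := le_trans (le_max_left _ _) (le_max_left _ _)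
  have hM2 : μ₂ * kM / (α + 1) ≤ M := le_trans (le_max_right _ _) (le_max_left _ _)
  have hM3 : μ₃ * kM / (β + 1) ≤ M := le_max_right _ _
  have hkM0 : 0 < kM := lt_of_lt_of_le (hk ⟨0, hN⟩) (hkM _)
  have hM0 : 0 ≤ M := le_trans (by positivity) hM1
  let e : Fin 3 → ℝ := ![1, (α + 1) / 2, (β + 1) / 2]
  let f : (Fin N × Fin q) × Fin 3 → ℝ := fun x => ((ς x.1.1 x.1.2) ^ 2) ^ (e x.2)
  have hf : ∀ x, 0 ≤ f x := fun x => Real.rpow_nonneg (sq_nonneg _) _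
  have hfsum : ∑ x, f x = ∑ i, (∑ j, (ς i j) ^ 2 + ∑ j, |ς i j| ^ (α + 1)
      + ∑ j, |ς i j| ^ (β + 1)) := by
    simp only [f, e, Fintype.sum_prod_type, Fin.sum_univ_three, aux_pow, ← Finset.sum_add_distrib]
    simp
  have hV0 : 0 ≤ ∑ i, k i * ((μ₁ / 2) * ∑ j, (ς i j) ^ 2
        + (μ₂ / (α + 1)) * ∑ j, |ς i j| ^ (α + 1)
        + (μ₃ / (β + 1)) * ∑ j, |ς i j| ^ (β + 1)) := by
    refine Finset.sum_nonneg fun i _ => ?_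
    have := hk i
    positivity
  have hV : ∑ i, k i * ((μ₁ / 2) * ∑ j, (ς i j) ^ 2
        + (μ₂ / (α + 1)) * ∑ j, |ς i j| ^ (α + 1)
        + (μ₃ / (β + 1)) * ∑ j, |ς i j| ^ (β + 1)) ≤ M * ∑ x, f x := by
    rw [hfsum, Finset.mul_sum]
    refine Finset.sum_le_sum fun i _ => ?_
    have hA : 0 ≤ ∑ j, (ς i j) ^ 2 := by positivity
    have hB : 0 ≤ ∑ j, |ς i j| ^ (α + 1) := by positivity
    have hC : 0 ≤ ∑ j, |ς i j| ^ (β + 1) := by positivity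
    have g : ∀ c, 0 < c → c * kM ≤ M → k i * c ≤ M := fun c hc h => by
      have := mul_le_mul_of_nonneg_right (hkM i) hc.le
      linarith
    have g1 := mul_le_mul_of_nonneg_right
      (g (μ₁ / 2) (by positivity) (by rw [div_mul_eq_mul_div]; exact hM1)) hA
    have g2 := mul_le_mul_of_nonneg_right
      (g (μ₂ / (α + 1)) (by positivity) (by rw [div_mul_eq_mul_div]; exact hM2)) hB
    have g3 := mul_le_mul_of_nonneg_right
      (g (μ₃ / (β + 1)) (by positivity) (by rw [div_mul_eq_mul_div]; exact hM3)) hC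
    linarith
  have hpm := Real.rpow_sum_le_const_mul_sum_rpow_of_nonneg (s := Finset.univ) (f := f) hp_one
    (fun x _ => hf x)
  have hcard : ((Finset.univ : Finset ((Fin N × Fin q) × Fin 3)).card : ℝ)
      = ((3 * N * q : ℕ) : ℝ) := by
    simp; ring
  rw [hcard] at hpm
  have hs' : s = ∑ x : Fin N × Fin q, (ς x.1 x.2) ^ 2 := by
    rw [hs, Fintype.sum_prod_type]
  have hsup : ∀ r : ℝ, 1 ≤ r → ∑ x : Fin N × Fin q, ((ς x.1 x.2) ^ 2) ^ r ≤ s ^ r := fun r hr => by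
    rw [hs']
    exact aux_super _ (fun x : Fin N × Fin q => (ς x.1 x.2) ^ 2) (fun _ => sq_nonneg _) r hr
  have hfp : ∑ x, f x ^ p ≤ 3 * s ^ β + s + s ^ α := by
    have h0 : ∑ x, f x ^ p = ∑ x : Fin N × Fin q, ((ς x.1 x.2) ^ 2) ^ p
        + ∑ x : Fin N × Fin q, ((ς x.1 x.2) ^ 2) ^ ((α + 1) / 2 * p)
        + ∑ x : Fin N × Fin q, ((ς x.1 x.2) ^ 2) ^ ((β + 1) / 2 * p) := by
      rw [Fintype.sum_prod_type]
      simp only [f, ← Real.rpow_mul (sq_nonneg _), Fin.sum_univ_three, Finset.sum_add_distrib]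
      simp [e]
    have e3 : (β + 1) / 2 * p = β := by rw [hp]; field_simp
    have e2 : (α + 1) / 2 * p = (α * β + β) / (β + 1) := by rw [hp]; field_simp
    have r1 : 1 ≤ (α * β + β) / (β + 1) := by rw [le_div_iff₀ (by linarith)]; linarith
    have r2 : (α * β + β) / (β + 1) ≤ β := by
      rw [div_le_iff₀ (by linarith)]; nlinarith
    have r3 : p ≤ β := by rw [hp, div_le_iff₀ (by linarith)]; nlinarith
    rw [h0, e2, e3]
    have a1 := hsup p hp_one
    have a2 := hsup _ r1
    have a3 := hsup β hβ.le
    have b1 := aux_between s 1 p β hs0 one_pos hp_one r3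
    have b2 := aux_between s α _ β hs0 hα0 (hα1.le.trans r1) r2
    rw [Real.rpow_one] at b1
    linarith
  rw [hp1]
  calc _ ≤ (M * ∑ x, f x) ^ p := Real.rpow_le_rpow hV0 hV (by linarith)
    _ = M ^ p * (∑ x, f x) ^ p := Real.mul_rpow hM0 (Finset.sum_nonneg fun x _ => hf x)
    _ ≤ M ^ p * (((3 * N * q : ℕ) : ℝ) ^ (p - 1) * (3 * s ^ β + s + s ^ α)) := by
      refine mul_le_mul_of_nonneg_left (hpm.trans ?_) (Real.rpow_nonneg hM0 _)
      exact mul_le_mul_of_nonneg_left hfp (by positivity)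
    _ = _ := by ring
end

section
/- Let q ≥ 1, let x ∈ ℝ^q, let S be a real q×q matrix, and let α be a real number with 0 < α < 1. Then |⟨sig^α(x), S x⟩| ≤ q^{(1−α)/2} ‖S‖ Σ_{i=1}^q |x_i|^{α+1}, where ⟨·,·⟩ is the Euclidean inner product, Sx is the matrix–vector product, and ‖S‖ is the operator norm of S with respect to the Euclidean norm on ℝ^q. -/
/-- The signed power function `sig^c(x)`, applied componentwise:
`(sig c x) i = sign (x i) * |x i| ^ c`. -/
noncomputable def sig {q : ℕ} (c : ℝ) (x : Fin q → ℝ) : Fin q → ℝ :=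
  fun i => Real.sign (x i) * |x i| ^ c

/-- The operator norm of a real matrix, viewed as a linear map on Euclidean space. -/
noncomputable def opNorm {q : ℕ} (S : Matrix (Fin q) (Fin q) ℝ) : ℝ :=
  ‖LinearMap.toContinuousLinearMap (Matrix.toEuclideanLin S)‖

lemma aux_ineq (q : ℕ) (hq : 1 ≤ q) (a : Fin q → ℝ) (ha : ∀ i, 0 ≤ a i)
    (α : ℝ) (hα0 : 0 < α) (hα1 : α < 1) :
    (∑ i, (a i ^ α) ^ 2) * (∑ i, (a i) ^ 2) ≤
      ((q : ℝ) ^ ((1 - α) / 2) * ∑ i, a i ^ (α + 1)) ^ 2 := by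
  set T := ∑ i, a i ^ (α + 1) with hT
  have hy : ∀ i, 0 ≤ a i ^ (α + 1) := fun i => Real.rpow_nonneg (ha i) _
  have hT0 : 0 ≤ T := Finset.sum_nonneg fun i _ => hy i
  have hq1 : (1 : ℝ) ≤ q := by exact_mod_cast hq
  have hq0 : (0 : ℝ) < q := by linarith
  have h1a : 0 < α + 1 := by linarith
  set U := ∑ i, (a i ^ α) ^ 2 with hU
  have hU0 : 0 ≤ U := Finset.sum_nonneg fun i _ => sq_nonneg _
  -- first factor
  have h1 : U ≤ (q : ℝ) ^ (1 - α) * T ^ (2 * α / (α + 1)) := by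
    have hp : 1 ≤ (α + 1) / (2 * α) := by
      rw [le_div_iff₀ (by linarith)]; linarith
    have h := Real.rpow_sum_le_const_mul_sum_rpow (Finset.univ : Finset (Fin q))
      (fun i => (a i ^ α) ^ 2) hp
    have e1 : ∀ i, |(a i ^ α) ^ 2| = (a i ^ α) ^ 2 := fun i => abs_of_nonneg (sq_nonneg _)
    have e2 : ∀ i, ((a i ^ α) ^ 2) ^ ((α + 1) / (2 * α)) = a i ^ (α + 1) := by
      intro i
      rw [← Real.rpow_natCast, ← Real.rpow_mul (ha i), ← Real.rpow_mul (ha i)]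
      congr 1
      push_cast
      field_simp
    simp only [e1, e2, Finset.card_univ, Fintype.card_fin] at h
    have h2 := Real.rpow_le_rpow (Real.rpow_nonneg hU0 _) h
      (show 0 ≤ 2 * α / (α + 1) by positivity)
    rw [← Real.rpow_mul hU0, Real.mul_rpow (by positivity) hT0, ← Real.rpow_mul hq0.le] at h2
    have e3 : (α + 1) / (2 * α) * (2 * α / (α + 1)) = 1 := by field_simp
    rw [e3, Real.rpow_one] at h2
    refine h2.trans ?_
    gcongr
    · have : ((α + 1) / (2 * α) - 1) * (2 * α / (α + 1)) = (1 - α) / (α + 1) := by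
        field_simp; ring
      rw [this]
      exact div_le_self (by linarith) (by linarith)
  have h2 : ∑ i, (a i) ^ 2 ≤ T ^ (2 / (α + 1)) := by
    have hr : 2 / (α + 1) = 1 + (1 - α) / (α + 1) := by field_simp; ring
    have hs : 0 ≤ (1 - α) / (α + 1) := div_nonneg (by linarith) h1a.le
    have : T ^ (2 / (α + 1)) = ∑ i, a i ^ (α + 1) * T ^ ((1 - α) / (α + 1)) := by
      rw [← Finset.sum_mul, ← hT, hr, Real.rpow_add_of_nonneg hT0 zero_le_one hs, Real.rpow_one]
    rw [this]
    refine Finset.sum_le_sum fun i _ => ?_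
    have hle : a i ^ (α + 1) ≤ T :=
      Finset.single_le_sum (f := fun i => a i ^ (α + 1)) (fun i _ => hy i) (Finset.mem_univ i)
    calc a i ^ 2 = a i ^ (α + 1) * (a i ^ (α + 1)) ^ ((1 - α) / (α + 1)) := by
          rw [← Real.rpow_mul (ha i), mul_div_cancel₀ _ h1a.ne',
            ← Real.rpow_add_of_nonneg (ha i) h1a.le (by linarith), ← Real.rpow_natCast]
          congr 1; push_cast; ring
      _ ≤ _ := by 
          gcongr
          · exact hy i
          · exact hy i
  calc U * ∑ i, (a i) ^ 2
      ≤ ((q : ℝ) ^ (1 - α) * T ^ (2 * α / (α + 1))) * T ^ (2 / (α + 1)) :=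
        mul_le_mul h1 h2 (Finset.sum_nonneg fun i _ => sq_nonneg _) (by positivity)
    _ = _ := by
      rw [mul_assoc, ← Real.rpow_add_of_nonneg hT0 (by positivity) (by positivity), mul_pow,
        ← Real.rpow_natCast ((q : ℝ) ^ ((1 - α) / 2)), ← Real.rpow_mul hq0.le,
        ← Real.rpow_natCast T]
      congr 2
      · push_cast; ring
      · push_cast; field_simp

/-- `|⟨sig^α(x), S x⟩| ≤ q^((1-α)/2) ‖S‖ Σᵢ |xᵢ|^(α+1)` for `0 < α < 1`. -/
theorem stmt_11 (q : ℕ) (hq : 1 ≤ q) (x : Fin q → ℝ) (S : Matrix (Fin q) (Fin q) ℝ)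
    (α : ℝ) (hα0 : 0 < α) (hα1 : α < 1) :
    |∑ i, sig α x i * S.mulVec x i| ≤
      (q : ℝ) ^ ((1 - α) / 2) * opNorm S * ∑ i, |x i| ^ (α + 1) := by
  have hN : 0 ≤ opNorm S := norm_nonneg _
  have hT0 : 0 ≤ ∑ i, |x i| ^ (α + 1) :=
    Finset.sum_nonneg fun i _ => Real.rpow_nonneg (abs_nonneg _) _
  have key := aux_ineq q hq (fun i => |x i|) (fun i => abs_nonneg _) α hα0 hα1
  have hop : ∑ i, (S.mulVec x i) ^ 2 ≤ opNorm S ^ 2 * ∑ i, |x i| ^ 2 := by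
    have h := (LinearMap.toContinuousLinearMap (Matrix.toEuclideanLin S)).le_opNorm
      (WithLp.toLp 2 x)
    have h2 := pow_le_pow_left₀ (norm_nonneg _) h 2
    rw [mul_pow, EuclideanSpace.norm_sq_eq, EuclideanSpace.norm_sq_eq] at h2
    simpa [opNorm, Matrix.toLpLin_toLp] using h2
  have hsig : ∑ i, (sig α x i) ^ 2 ≤ ∑ i, (|x i| ^ α) ^ 2 := by
    refine Finset.sum_le_sum fun i _ => ?_
    unfold sig
    rw [mul_pow]
    refine mul_le_of_le_one_left (sq_nonneg _) ?_
    rcases Real.sign_apply_eq (x i) with h | h | h <;> rw [h] <;> norm_num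
  refine abs_le_of_sq_le_sq ?_ (by positivity)
  calc (∑ i, sig α x i * S.mulVec x i) ^ 2
      ≤ (∑ i, (sig α x i) ^ 2) * ∑ i, (S.mulVec x i) ^ 2 :=
        Finset.sum_mul_sq_le_sq_mul_sq _ _ _
    _ ≤ (∑ i, (|x i| ^ α) ^ 2) * (opNorm S ^ 2 * ∑ i, |x i| ^ 2) :=
        mul_le_mul hsig hop (Finset.sum_nonneg fun i _ => sq_nonneg _)
          (Finset.sum_nonneg fun i _ => sq_nonneg _)
    _ = opNorm S ^ 2 * ((∑ i, (|x i| ^ α) ^ 2) * ∑ i, |x i| ^ 2) := by ring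
    _ ≤ opNorm S ^ 2 * ((q : ℝ) ^ ((1 - α) / 2) * ∑ i, |x i| ^ (α + 1)) ^ 2 :=
        mul_le_mul_of_nonneg_left key (sq_nonneg _)
    _ = _ := by ring
end

section
/- Let q ≥ 1, let x ∈ ℝ^q, let S be a real q×q matrix, and let β be a real number with β > 1. Then |⟨sig^β(x), S x⟩| ≤ q^{(β−1)/2} ‖S‖ Σ_{i=1}^q |x_i|^{β+1}, where ⟨·,·⟩ is the Euclidean inner product, Sx is the matrix–vector product, and ‖S‖ is the operator norm of S with respect to the Euclidean norm on ℝ^q. -/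
/-- The scalar inequality behind the estimate. -/
lemma key_ineq (q : ℕ) (hq : 1 ≤ q) (x : Fin q → ℝ) (β : ℝ) (hβ : 1 < β) :
    (∑ i, (|x i| ^ β) ^ 2) * (∑ i, x i ^ 2) ≤
      ((q : ℝ) ^ ((β - 1) / 2) * ∑ i, |x i| ^ (β + 1)) ^ 2 := by
  set N := ∑ i, x i ^ 2 with hN
  set T := ∑ i, |x i| ^ (β + 1) with hT
  have hN0 : 0 ≤ N := Finset.sum_nonneg fun i _ => sq_nonneg _
  have hT0 : 0 ≤ T := Finset.sum_nonneg fun i _ => by positivity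
  have h1 : ∑ i, (|x i| ^ β) ^ 2 ≤ T * N ^ ((β - 1) / 2) := by
    rw [hT, Finset.sum_mul]
    refine Finset.sum_le_sum fun i _ => ?_
    have e1 : (|x i| ^ β) ^ 2 = |x i| ^ (β + 1) * (x i ^ 2) ^ ((β - 1) / 2) := by
      rw [← sq_abs (x i), ← Real.rpow_natCast (|x i|) 2, ← Real.rpow_mul (abs_nonneg _),
        ← Real.rpow_natCast, ← Real.rpow_mul (abs_nonneg _),
        ← Real.rpow_add_of_nonneg (abs_nonneg _) (by linarith) (by push_cast; linarith)]
      congr 1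
      push_cast
      ring
    rw [e1]
    have : x i ^ 2 ≤ N :=
      Finset.single_le_sum (f := fun i => x i ^ 2) (fun i _ => sq_nonneg _) (Finset.mem_univ i)
    gcongr
  have h2 : N ^ ((β + 1) / 2) ≤ (q : ℝ) ^ ((β - 1) / 2) * T := by
    have h := Real.rpow_sum_le_const_mul_sum_rpow (Finset.univ : Finset (Fin q))
      (fun i => x i ^ 2) (p := (β + 1) / 2) (by linarith)
    have e : (β + 1) / 2 - 1 = (β - 1) / 2 := by ring
    have e2 : ∀ i, (|x i ^ 2|) ^ ((β + 1) / 2) = |x i| ^ (β + 1) := fun i => by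
      rw [abs_pow, ← Real.rpow_natCast, ← Real.rpow_mul (abs_nonneg _)]
      congr 1
      push_cast
      ring
    simp only [e2, e] at h
    simpa using h
  have h3 : N ^ ((β - 1) / 2) * N = N ^ ((β + 1) / 2) := by
    nth_rewrite 2 [← Real.rpow_one N]
    rw [← Real.rpow_add_of_nonneg hN0 (by linarith) (by norm_num)]
    congr 1
    ring
  have h4 : (1 : ℝ) ≤ (q : ℝ) ^ ((β - 1) / 2) :=
    Real.one_le_rpow (by exact_mod_cast hq) (by linarith)
  calc _ ≤ T * N ^ ((β - 1) / 2) * N := by gcongr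
    _ = T * N ^ ((β + 1) / 2) := by rw [mul_assoc, h3]
    _ ≤ T * ((q : ℝ) ^ ((β - 1) / 2) * T) := by gcongr
    _ ≤ ((q : ℝ) ^ ((β - 1) / 2) * T) * ((q : ℝ) ^ ((β - 1) / 2) * T) := by
        gcongr
        exact le_mul_of_one_le_left hT0 h4
    _ = _ := by ring

/-- `|⟨sig^β(x), S x⟩| ≤ q^((β-1)/2) ‖S‖ Σᵢ |xᵢ|^(β+1)` for `β > 1`. -/
theorem stmt_12 (q : ℕ) (hq : 1 ≤ q) (x : Fin q → ℝ) (S : Matrix (Fin q) (Fin q) ℝ)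
    (β : ℝ) (hβ : 1 < β) :
    |∑ i, sig β x i * S.mulVec x i| ≤
      (q : ℝ) ^ ((β - 1) / 2) * opNorm S * ∑ i, |x i| ^ (β + 1) := by
  have hS0 : 0 ≤ opNorm S := norm_nonneg _
  have hT0 : 0 ≤ ∑ i, |x i| ^ (β + 1) := Finset.sum_nonneg fun i _ => by positivity
  refine abs_le_of_sq_le_sq ?_ (by positivity)
  have hcs := Finset.sum_mul_sq_le_sq_mul_sq Finset.univ (sig β x) (S.mulVec x)
  have hsig : ∑ i, sig β x i ^ 2 ≤ ∑ i, (|x i| ^ β) ^ 2 := by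
    refine Finset.sum_le_sum fun i _ => ?_
    unfold sig
    rw [mul_pow]
    have : Real.sign (x i) ^ 2 ≤ 1 := by
      rcases Real.sign_apply_eq (x i) with h | h | h <;> rw [h] <;> norm_num
    exact mul_le_of_le_one_left (by positivity) this
  have hop : ∑ i, S.mulVec x i ^ 2 ≤ opNorm S ^ 2 * ∑ i, x i ^ 2 := by
    have h := (LinearMap.toContinuousLinearMap (Matrix.toEuclideanLin S)).le_opNorm
      (WithLp.toLp 2 x)
    have h' := pow_le_pow_left₀ (norm_nonneg _) h 2
    rw [mul_pow, EuclideanSpace.norm_sq_eq, EuclideanSpace.norm_sq_eq] at h'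
    simpa [opNorm, Matrix.toLpLin_toLp] using h'
  have hk := key_ineq q hq x β hβ
  calc _ ≤ _ := hcs
    _ ≤ (∑ i, (|x i| ^ β) ^ 2) * (opNorm S ^ 2 * ∑ i, x i ^ 2) := by gcongr
    _ = opNorm S ^ 2 * ((∑ i, (|x i| ^ β) ^ 2) * ∑ i, x i ^ 2) := by ring
    _ ≤ opNorm S ^ 2 * ((q : ℝ) ^ ((β - 1) / 2) * ∑ i, |x i| ^ (β + 1)) ^ 2 := by gcongr
    _ = _ := by ring
end

section
/- Let N, q ≥ 1, let 0 < α < 1 < β, let μ₁, μ₂, μ₃ > 0, let k₁,…,k_N > 0, let S be a real q×q matrix, and let ς₁,…,ς_N ∈ ℝ^q. Define V = Σ_{i=1}^N k_i( (μ₁/2)Σ_{j=1}^q ς_{ij}² + (μ₂/(α+1))Σ_{j=1}^q |ς_{ij}|^{α+1} + (μ₃/(β+1))Σ_{j=1}^q |ς_{ij}|^{β+1} ). Then Σ_{i=1}^N k_i( μ₁|⟨ς_i, Sς_i⟩| + μ₂|⟨sig^α(ς_i), Sς_i⟩| + μ₃|⟨sig^β(ς_i), Sς_i⟩| ) ≤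 c₅ V, where c₅ = max{ q^{(1−α)/2}, q^{(β−1)/2} } · ‖S‖ · (β+1), ⟨·,·⟩ is the Euclidean inner product on ℝ^q, and ‖S‖ is the operator norm of S with respect to the Euclidean norm. -/
lemma aux_cs {q : ℕ} (S : Matrix (Fin q) (Fin q) ℝ) (y x : Fin q → ℝ) :
    |∑ j, y j * S.mulVec x j| ≤ opNorm S * (√(∑ j, y j ^ 2) * √(∑ j, x j ^ 2)) := by
  have h1 := abs_real_inner_le_norm (WithLp.toLp 2 (S.mulVec x) : EuclideanSpace ℝ (Fin q))
    (WithLp.toLp 2 y)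
  have h2 := (LinearMap.toContinuousLinearMap (Matrix.toEuclideanLin S)).le_opNorm
    (WithLp.toLp 2 x)
  have e1 : (LinearMap.toContinuousLinearMap (Matrix.toEuclideanLin S)) (WithLp.toLp 2 x)
      = WithLp.toLp 2 (S.mulVec x) := by
    simp [Matrix.toLpLin_toLp]
  rw [e1] at h2
  have n (z : Fin q → ℝ) : ‖(WithLp.toLp 2 z : EuclideanSpace ℝ (Fin q))‖ = √(∑ j, z j ^ 2) := by
    simp [EuclideanSpace.norm_eq]
  have e2 : inner ℝ (WithLp.toLp 2 (S.mulVec x) : EuclideanSpace ℝ (Fin q)) (WithLp.toLp 2 y)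
      = ∑ j, y j * S.mulVec x j := by
    simp [PiLp.inner_apply]
  rw [e2] at h1
  rw [n x] at h2
  rw [n y] at h1
  change _ ≤ opNorm S * _ at h2
  calc _ ≤ _ := h1
    _ ≤ (opNorm S * √(∑ j, x j ^ 2)) * √(∑ j, y j ^ 2) := by gcongr
    _ = _ := by ring

lemma aux_big {q : ℕ} (b : Fin q → ℝ) (hb : ∀ j, 0 ≤ b j) (s : ℝ) (hs : 1 ≤ s) :
    ∑ j, b j ^ s ≤ (∑ j, b j) ^ s := by
  have hA : 0 ≤ ∑ j, b j := Finset.sum_nonneg fun j _ => hb j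
  have key (t : ℝ) (ht : 0 ≤ t) : t ^ s = t * t ^ (s - 1) := by
    rw [← Real.rpow_one_add' ht (by linarith)]; congr 1; ring
  rw [key _ hA, Finset.sum_mul]
  refine Finset.sum_le_sum fun j _ => ?_
  rw [key _ (hb j)]
  refine mul_le_mul_of_nonneg_left (Real.rpow_le_rpow (hb j) ?_ (by linarith)) (hb j)
  exact Finset.single_le_sum (fun j _ => hb j) (Finset.mem_univ j)

lemma aux_small {q : ℕ} (b : Fin q → ℝ) (hb : ∀ j, 0 ≤ b j) (r : ℝ) (hr0 : 0 < r) (hr : r ≤ 1) :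
    ∑ j, b j ^ r ≤ (q : ℝ) ^ (1 - r) * (∑ j, b j) ^ r := by
  have hA : 0 ≤ ∑ j, b j := Finset.sum_nonneg fun j _ => hb j
  have hX : 0 ≤ ∑ j, b j ^ r := Finset.sum_nonneg fun j _ => Real.rpow_nonneg (hb j) _
  have h := Real.rpow_sum_le_const_mul_sum_rpow_of_nonneg (s := Finset.univ)
    (f := fun j => b j ^ r) (p := 1 / r) (by rw [le_div_iff₀ hr0]; linarith)
    (fun j _ => Real.rpow_nonneg (hb j) _)
  have e : ∀ j, (b j ^ r) ^ (1 / r) = b j := fun j => by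
    rw [← Real.rpow_mul (hb j), mul_one_div_cancel hr0.ne', Real.rpow_one]
  simp only [e, Finset.card_univ, Fintype.card_fin] at h
  have h2 := Real.rpow_le_rpow (Real.rpow_nonneg hX _) h hr0.le
  rw [← Real.rpow_mul hX, one_div_mul_cancel hr0.ne', Real.rpow_one,
    Real.mul_rpow (by positivity) hA, ← Real.rpow_mul (by positivity)] at h2
  convert h2 using 3
  field_simp

lemma aux_prod {q : ℕ} (b : Fin q → ℝ) (hb : ∀ j, 0 ≤ b j) (r s : ℝ) (hr0 : 0 < r) (hr : r ≤ 1)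
    (hrs : r + s = 2) :
    √(∑ j, b j ^ r) * √(∑ j, b j ^ s) ≤ (q : ℝ) ^ ((1 - r) / 2) * ∑ j, b j := by
  have hA : 0 ≤ ∑ j, b j := Finset.sum_nonneg fun j _ => hb j
  have hX : 0 ≤ ∑ j, b j ^ r := Finset.sum_nonneg fun j _ => Real.rpow_nonneg (hb j) _
  have hY : 0 ≤ ∑ j, b j ^ s := Finset.sum_nonneg fun j _ => Real.rpow_nonneg (hb j) _
  rw [← Real.sqrt_mul hX]
  apply Real.sqrt_le_iff.2 ⟨by positivity, ?_⟩
  calc _ ≤ ((q : ℝ) ^ (1 - r) * (∑ j, b j) ^ r) * (∑ j, b j) ^ s :=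
        mul_le_mul (aux_small b hb r hr0 hr) (aux_big b hb s (by linarith)) hY (by positivity)
    _ = (q : ℝ) ^ (1 - r) * (∑ j, b j) ^ (2 : ℝ) := by
        rw [mul_assoc, ← Real.rpow_add' hA (by linarith), hrs]
    _ = _ := by
        rw [mul_pow, ← Real.rpow_natCast ((q : ℝ) ^ _), ← Real.rpow_mul (by positivity),
          Real.rpow_two]
        congr 2
        push_cast; ring

lemma aux_sig {q : ℕ} (c : ℝ) (hc : 0 < c) (x : Fin q → ℝ) :
    ∑ j, sig c x j ^ 2 ≤ ∑ j, (|x j| ^ (c + 1)) ^ (2 * c / (c + 1)) := by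
  refine Finset.sum_le_sum fun j _ => ?_
  rw [← Real.rpow_mul (abs_nonneg _), mul_div_cancel₀ _ (by linarith : c + 1 ≠ 0), mul_comm 2 c,
    Real.rpow_mul (abs_nonneg _), Real.rpow_two, sig, mul_pow]
  refine mul_le_of_le_one_left (by positivity) ?_
  rcases Real.sign_apply_eq (x j) with h | h | h <;> rw [h] <;> norm_num

lemma aux_sq {q : ℕ} (c : ℝ) (hc : 0 < c) (x : Fin q → ℝ) :
    ∑ j, x j ^ 2 = ∑ j, (|x j| ^ (c + 1)) ^ (2 / (c + 1)) := by
  refine Finset.sum_congr rfl fun j _ => ?_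
  rw [← Real.rpow_mul (abs_nonneg _), mul_div_cancel₀ _ (by linarith : c + 1 ≠ 0),
    Real.rpow_two, sq_abs]

lemma aux_alpha {q : ℕ} (hq : 1 ≤ q) (c : ℝ) (hc : 0 < c) (hc1 : c < 1)
    (S : Matrix (Fin q) (Fin q) ℝ) (x : Fin q → ℝ) :
    |∑ j, sig c x j * S.mulVec x j| ≤
      opNorm S * ((q : ℝ) ^ ((1 - c) / 2) * ∑ j, |x j| ^ (c + 1)) := by
  have hS : 0 ≤ opNorm S := norm_nonneg _
  have hq' : (1 : ℝ) ≤ q := by exact_mod_cast hq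
  refine (aux_cs S _ x).trans (mul_le_mul_of_nonneg_left ?_ hS)
  have h := aux_prod (fun j => |x j| ^ (c + 1)) (fun j => by positivity) (2 * c / (c + 1))
    (2 / (c + 1)) (by positivity) (by rw [div_le_one (by linarith)]; linarith) (by field_simp)
  rw [← aux_sq c hc x] at h
  calc _ ≤ _ := mul_le_mul_of_nonneg_right (Real.sqrt_le_sqrt (aux_sig c hc x)) (by positivity)
    _ ≤ _ := h
    _ ≤ _ := by
      refine mul_le_mul_of_nonneg_right (Real.rpow_le_rpow_of_exponent_le hq' ?_)
        (Finset.sum_nonneg fun j _ => by positivity)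
      have : c ≤ 2 * c / (c + 1) := by rw [le_div_iff₀ (by linarith)]; nlinarith
      linarith

lemma aux_beta {q : ℕ} (hq : 1 ≤ q) (c : ℝ) (hc1 : 1 < c)
    (S : Matrix (Fin q) (Fin q) ℝ) (x : Fin q → ℝ) :
    |∑ j, sig c x j * S.mulVec x j| ≤
      opNorm S * ((q : ℝ) ^ ((c - 1) / 2) * ∑ j, |x j| ^ (c + 1)) := by
  have hc : 0 < c := by linarith
  have hS : 0 ≤ opNorm S := norm_nonneg _
  have hq' : (1 : ℝ) ≤ q := by exact_mod_cast hq
  refine (aux_cs S _ x).trans (mul_le_mul_of_nonneg_left ?_ hS)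
  have h := aux_prod (fun j => |x j| ^ (c + 1)) (fun j => by positivity) (2 / (c + 1))
    (2 * c / (c + 1)) (by positivity) (by rw [div_le_one (by linarith)]; linarith)
    (by field_simp; ring)
  rw [← aux_sq c hc x, mul_comm (√_)] at h
  calc _ ≤ _ := mul_le_mul_of_nonneg_right (Real.sqrt_le_sqrt (aux_sig c hc x)) (by positivity)
    _ ≤ _ := h
    _ ≤ _ := by
      refine mul_le_mul_of_nonneg_right (Real.rpow_le_rpow_of_exponent_le hq' ?_)
        (Finset.sum_nonneg fun j _ => by positivity)
      have : 2 - c ≤ 2 / (c + 1) := by rw [le_div_iff₀ (by linarith)]; nlinarith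
      linarith

/-- the bound `Σᵢ kᵢ (μ₁|⟨ςᵢ, Sςᵢ⟩| + μ₂|⟨sig^α(ςᵢ), Sςᵢ⟩|
+ μ₃|⟨sig^β(ςᵢ), Sςᵢ⟩|) ≤ c₅ V` with
`c₅ = max{q^((1-α)/2), q^((β-1)/2)} ‖S‖ (β+1)`. -/
theorem stmt_13 (N q : ℕ) (hN : 1 ≤ N) (hq : 1 ≤ q)
    (α β μ₁ μ₂ μ₃ : ℝ) (hα0 : 0 < α) (hα1 : α < 1) (hβ : 1 < β)
    (hμ₁ : 0 < μ₁) (hμ₂ : 0 < μ₂) (hμ₃ : 0 < μ₃)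
    (k : Fin N → ℝ) (hk : ∀ i, 0 < k i)
    (S : Matrix (Fin q) (Fin q) ℝ) (ς : Fin N → Fin q → ℝ) :
    (∑ i, k i * (μ₁ * |∑ j, ς i j * S.mulVec (ς i) j|
        + μ₂ * |∑ j, sig α (ς i) j * S.mulVec (ς i) j|
        + μ₃ * |∑ j, sig β (ς i) j * S.mulVec (ς i) j|)) ≤
      max ((q : ℝ) ^ ((1 - α) / 2)) ((q : ℝ) ^ ((β - 1) / 2)) * opNorm S * (β + 1) *
        (∑ i, k i * ((μ₁ / 2) * ∑ j, (ς i j) ^ 2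
          + (μ₂ / (α + 1)) * ∑ j, |ς i j| ^ (α + 1)
          + (μ₃ / (β + 1)) * ∑ j, |ς i j| ^ (β + 1))) := by
  have hS : 0 ≤ opNorm S := norm_nonneg _
  have hq' : (1 : ℝ) ≤ q := by exact_mod_cast hq
  set M := max ((q : ℝ) ^ ((1 - α) / 2)) ((q : ℝ) ^ ((β - 1) / 2)) with hM
  have hM1 : 1 ≤ M := (Real.one_le_rpow hq' (by linarith)).trans (le_max_left _ _)
  rw [Finset.mul_sum]
  refine Finset.sum_le_sum fun i _ => ?_
  rw [mul_left_comm]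
  refine mul_le_mul_of_nonneg_left ?_ (hk i).le
  have hA0 : 0 ≤ ∑ j, (ς i j) ^ 2 := Finset.sum_nonneg fun j _ => by positivity
  have hA1 : 0 ≤ ∑ j, |ς i j| ^ (α + 1) := Finset.sum_nonneg fun j _ => by positivity
  have hA2 : 0 ≤ ∑ j, |ς i j| ^ (β + 1) := Finset.sum_nonneg fun j _ => by positivity
  have h0 := aux_cs S (ς i) (ς i)
  rw [Real.mul_self_sqrt hA0] at h0
  have h1 := aux_alpha hq α hα0 hα1 S (ς i)
  have h2 := aux_beta hq β hβ S (ς i)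
  have hl : (q : ℝ) ^ ((1 - α) / 2) ≤ M := le_max_left _ _
  have hr : (q : ℝ) ^ ((β - 1) / 2) ≤ M := le_max_right _ _
  generalize (∑ j, (ς i j) ^ 2) = A0 at *
  generalize (∑ j, |ς i j| ^ (α + 1)) = A1 at *
  generalize (∑ j, |ς i j| ^ (β + 1)) = A2 at *
  have g0 : μ₁ * |∑ j, ς i j * S.mulVec (ς i) j| ≤ M * opNorm S * (β + 1) * (μ₁ / 2 * A0) := by
    calc _ ≤ μ₁ * (opNorm S * A0) := by gcongr
      _ = (1 * 2) * (opNorm S * (μ₁ / 2 * A0)) := by ring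
      _ ≤ (M * (β + 1)) * (opNorm S * (μ₁ / 2 * A0)) := by gcongr; linarith
      _ = _ := by ring
  have g1 : μ₂ * |∑ j, sig α (ς i) j * S.mulVec (ς i) j| ≤
      M * opNorm S * (β + 1) * (μ₂ / (α + 1) * A1) := by
    calc _ ≤ μ₂ * (opNorm S * (M * A1)) := by
          refine mul_le_mul_of_nonneg_left (h1.trans ?_) hμ₂.le
          gcongr
      _ = (α + 1) * (M * opNorm S * (μ₂ / (α + 1) * A1)) := by field_simp
      _ ≤ (β + 1) * (M * opNorm S * (μ₂ / (α + 1) * A1)) := by gcongr; linarith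
      _ = _ := by ring
  have g2 : μ₃ * |∑ j, sig β (ς i) j * S.mulVec (ς i) j| ≤
      M * opNorm S * (β + 1) * (μ₃ / (β + 1) * A2) := by
    calc _ ≤ μ₃ * (opNorm S * (M * A2)) := by
          refine mul_le_mul_of_nonneg_left (h2.trans ?_) hμ₃.le
          gcongr
      _ = _ := by field_simp
  linarith
end

section
/- Let V : ℝ → ℝ be continuous and nonnegative, let c > 0, θ ∈ (0,1), and t₁ ∈ ℝ. Suppose V is differentiable on [t₁,∞) with V′(t) ≤ −c·V(t)^θ for all t ≥ t₁. Then V(t) = 0 for all t ≥ t₁ + V(t₁)^{1−θ} / (c(1−θ)). -/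
/-- a continuous nonnegative function satisfying the differential
inequality `V' ≤ -c V^θ` on `[t₁, ∞)` with `c > 0`, `θ ∈ (0,1)` vanishes after
the finite time `t₁ + V(t₁)^(1-θ) / (c (1-θ))`. -/
theorem stmt_14 (V : ℝ → ℝ) (c θ t₁ : ℝ) (hc : 0 < c) (hθ0 : 0 < θ) (hθ1 : θ < 1)
    (hcont : Continuous V) (hnonneg : ∀ t, 0 ≤ V t)
    (hdiff : ∀ t, t₁ ≤ t → DifferentiableAt ℝ V t)
    (hderiv : ∀ t, t₁ ≤ t → deriv V t ≤ -c * (V t) ^ θ) :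
    ∀ t, t₁ + (V t₁) ^ (1 - θ) / (c * (1 - θ)) ≤ t → V t = 0 := by
  intro t ht
  have h1θ : 0 < 1 - θ := by linarith
  have hk : 0 < c * (1 - θ) := mul_pos hc h1θ
  have hq : 0 ≤ (V t₁) ^ (1 - θ) / (c * (1 - θ)) :=
    div_nonneg (Real.rpow_nonneg (hnonneg _) _) hk.le
  have ht1 : t₁ ≤ t := by linarith
  have hanti : AntitoneOn V (Set.Ici t₁) := by
    apply antitoneOn_of_deriv_nonpos (convex_Ici t₁) hcont.continuousOn
    · intro x hx
      rw [interior_Ici] at hx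
      exact (hdiff x (le_of_lt hx)).differentiableWithinAt
    · intro x hx
      rw [interior_Ici] at hx
      have h1 := hderiv x (le_of_lt hx)
      have h2 := mul_nonneg hc.le (Real.rpow_nonneg (hnonneg x) θ)
      linarith
  by_contra hne
  have hpos : 0 < V t := lt_of_le_of_ne (hnonneg t) (Ne.symm hne)
  have hpos' : ∀ s ∈ Set.Icc t₁ t, 0 < V s := fun s hs =>
    lt_of_lt_of_le hpos (hanti hs.1 ht1 hs.2)
  have hd : ∀ s ∈ Set.Icc t₁ t, HasDerivAt (fun y => V y ^ (1 - θ) + c * (1 - θ) * y)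
      (deriv V s * (1 - θ) * V s ^ (1 - θ - 1) + c * (1 - θ) * 1) s := by
    intro s hs
    exact ((hdiff s hs.1).hasDerivAt.rpow_const (Or.inl (hpos' s hs).ne')).add
      ((hasDerivAt_id s).const_mul (c * (1 - θ)))
  have hW : AntitoneOn (fun y => V y ^ (1 - θ) + c * (1 - θ) * y) (Set.Icc t₁ t) := by
    apply antitoneOn_of_deriv_nonpos (convex_Icc t₁ t)
    · exact fun s hs => (hd s hs).continuousAt.continuousWithinAt
    · exact fun s hs => (hd s (interior_subset hs)).differentiableAt.differentiableWithinAt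
    · intro s hs
      have hs' := interior_subset hs
      rw [(hd s hs').deriv]
      have hp := hpos' s hs'
      have h1 : V s ^ θ * V s ^ (1 - θ - 1) = 1 := by
        rw [← Real.rpow_add hp]
        simp
      have h2 : 0 ≤ (1 - θ) * V s ^ (1 - θ - 1) :=
        mul_nonneg h1θ.le (Real.rpow_nonneg hp.le _)
      have h3 := mul_le_mul_of_nonneg_right (hderiv s hs'.1) h2
      have h4 : -c * V s ^ θ * ((1 - θ) * V s ^ (1 - θ - 1)) = -(c * (1 - θ)) := by
        linear_combination (-(c * (1 - θ))) * h1
      linarith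
  have hf := hW (Set.left_mem_Icc.2 ht1) (Set.right_mem_Icc.2 ht1) ht1
  have hVp : 0 < V t ^ (1 - θ) := Real.rpow_pos_of_pos hpos _
  have h5 : (V t₁) ^ (1 - θ) ≤ (t - t₁) * (c * (1 - θ)) := by
    rw [← div_le_iff₀ hk]
    linarith
  simp only at hf
  linarith
end

section
/- Let n ≥ 1 and let A be a real n×n matrix such that every eigenvalue of A, i.e., every root in ℂ of the characteristic polynomial of A, has strictly negative real part. Then for every symmetric positive definite real n×n matrix Q there exists a symmetric positive definite real n×n matrix P such that P·A + Aᵀ·P = −Q. -/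
open Matrix

lemma lyap_gen {R : Type*} [NormedRing R] [NormedAlgebra ℝ R] [CompleteSpace R]
    [FiniteDimensional ℝ R] (a b q : R) (h : Summable fun k : ℕ => ‖a ^ k‖ * ‖b ^ k‖) :
    ∃ p : R, p - a * p * b = q ∧
      ∀ f : R →ₗ[ℝ] ℝ, HasSum (fun k : ℕ => f (a ^ k * q * b ^ k)) (f p) := by
  have hs : Summable fun k : ℕ => a ^ k * q * b ^ k := by
    refine Summable.of_norm_bounded (h.mul_left ‖q‖) fun k => ?_
    calc ‖a ^ k * q * b ^ k‖ ≤ ‖a ^ k‖ * ‖q‖ * ‖b ^ k‖ :=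
          (norm_mul_le _ _).trans (by gcongr; exact norm_mul_le _ _)
      _ = _ := by ring
  refine ⟨∑' k, a ^ k * q * b ^ k, ?_, fun f => ?_⟩
  · have h1 := hs.tsum_eq_zero_add
    have h2 : a * (∑' k, a ^ k * q * b ^ k) * b = ∑' k, a ^ (k+1) * q * b ^ (k+1) := by
      rw [← hs.tsum_mul_left, ← (hs.mul_left a).tsum_mul_right]
      congr 1; ext k; rw [pow_succ', pow_succ]; simp only [mul_assoc]
    rw [h2]
    nth_rewrite 1 [h1]
    simp
  · exact hs.hasSum.mapL (LinearMap.toContinuousLinearMap f)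

lemma lyap_spec {R : Type*} [NormedRing R] [NormedAlgebra ℂ R] [CompleteSpace R] [Nontrivial R]
    (a : R) (h : ∀ μ ∈ spectrum ℂ a, ‖μ‖ < 1) :
    Summable fun k : ℕ => ‖a ^ k‖ * ‖a ^ k‖ := by
  have h1 : spectralRadius ℂ a < (1 : NNReal) :=
    spectrum.spectralRadius_lt_of_forall_lt a (fun μ hμ => by exact_mod_cast h μ hμ)
  obtain ⟨r, hr1, hr2⟩ := ENNReal.lt_iff_exists_nnreal_btwn.1 h1
  have hr2 : (r : ℝ) < 1 := by exact_mod_cast hr2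
  have ht := spectrum.pow_nnnorm_pow_one_div_tendsto_nhds_spectralRadius a
  have he := (ht.eventually (gt_mem_nhds hr1)).and (Filter.eventually_gt_atTop 0)
  have hb : ∀ᶠ k : ℕ in Filter.atTop, ‖a ^ k‖ ≤ (r : ℝ) ^ k := by
    filter_upwards [he] with k hk
    obtain ⟨hk, hk0⟩ := hk
    have hkp : (0:ℝ) < k := by exact_mod_cast hk0
    have := ENNReal.rpow_le_rpow hk.le hkp.le
    rw [← ENNReal.rpow_mul, one_div_mul_cancel hkp.ne', ENNReal.rpow_one,
      ENNReal.rpow_natCast] at this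
    exact_mod_cast this
  have hg : Summable fun k : ℕ => ((r:ℝ) * r) ^ k :=
    summable_geometric_of_lt_one (by positivity) (by nlinarith [r.2, r.coe_nonneg])
  refine summable_of_isBigO_nat hg (Asymptotics.IsBigO.of_bound 1 ?_)
  filter_upwards [hb] with k hk
  rw [one_mul, Real.norm_of_nonneg (by positivity), Real.norm_of_nonneg (by positivity), mul_pow]
  gcongr

lemma cayley_re (μ : ℂ) (h : ((μ - 1) / (μ + 1)).re < 0) : ‖μ‖ < 1 := by
  have h0 : μ + 1 ≠ 0 := by rintro h0; simp [h0] at h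
  have h1 : 0 < Complex.normSq (μ + 1) := Complex.normSq_pos.2 h0
  rw [Complex.div_re, ← add_div, div_lt_iff₀ h1, zero_mul] at h
  have : ‖μ‖ ^ 2 < 1 := by
    rw [Complex.sq_norm, Complex.normSq_apply]
    simp at h; nlinarith
  nlinarith [norm_nonneg μ]

section
attribute [local instance] Matrix.frobeniusNormedRing Matrix.frobeniusNormedAlgebra
  Matrix.frobeniusNormedAddCommGroup

lemma lyap_mat {n : ℕ} (hn : 1 ≤ n) (B Q : Matrix (Fin n) (Fin n) ℝ)
    (h : ∀ μ ∈ spectrum ℂ (B.map ((↑) : ℝ → ℂ)), ‖μ‖ < 1) :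
    ∃ p : Matrix (Fin n) (Fin n) ℝ, p - Bᵀ * p * B = Q ∧
      ∀ f : Matrix (Fin n) (Fin n) ℝ →ₗ[ℝ] ℝ,
        HasSum (fun k : ℕ => f (Bᵀ ^ k * Q * B ^ k)) (f p) := by
  have : NeZero n := ⟨by omega⟩
  have : CompleteSpace (Matrix (Fin n) (Fin n) ℂ) := FiniteDimensional.complete ℂ _
  have : CompleteSpace (Matrix (Fin n) (Fin n) ℝ) := FiniteDimensional.complete ℝ _
  refine lyap_gen Bᵀ B Q ?_
  have := lyap_spec _ h
  convert this using 2 with k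
  have e : ‖(B.map ((↑) : ℝ → ℂ)) ^ k‖ = ‖B ^ k‖ := by
    have : (B.map ((↑) : ℝ → ℂ)) ^ k = (B ^ k).map ((↑) : ℝ → ℂ) :=
      (Matrix.map_pow B Complex.ofRealHom k).symm
    rw [this]
    exact Matrix.frobenius_norm_map_eq _ _ (by simp)
  rw [e, ← Matrix.transpose_pow, Matrix.frobenius_norm_transpose]
end

/-- if every eigenvalue (root of the characteristic polynomial over
`ℂ`) of `A` has strictly negative real part, then for every symmetric positive
definite `Q` there is a symmetric positive definite `P` solving the Lyapunov
equation `P A + Aᵀ P = -Q`. -/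
theorem stmt_17 (n : ℕ) (hn : 1 ≤ n) (A : Matrix (Fin n) (Fin n) ℝ)
    (hA : ∀ μ : ℂ, (Matrix.charpoly (A.map ((↑) : ℝ → ℂ))).IsRoot μ → μ.re < 0) :
    ∀ Q : Matrix (Fin n) (Fin n) ℝ, Q.PosDef →
      ∃ P : Matrix (Fin n) (Fin n) ℝ, P.PosDef ∧ P * A + Aᵀ * P = -Q := by
  intro Q hQ
  set Ac := A.map ((↑) : ℝ → ℂ) with hAc
  have hsp : ∀ μ : ℂ, μ ∈ spectrum ℂ Ac → μ.re < 0 := fun μ hμ =>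
    hA μ (Matrix.mem_spectrum_iff_isRoot_charpoly.1 hμ)
  have hmap : ∀ X Y : Matrix (Fin n) (Fin n) ℝ, (X * Y).map ((↑) : ℝ → ℂ)
      = X.map ((↑) : ℝ → ℂ) * Y.map ((↑) : ℝ → ℂ) := fun X Y =>
    Matrix.map_mul (f := Complex.ofRealHom)
  have hone : (1 : Matrix (Fin n) (Fin n) ℝ).map ((↑) : ℝ → ℂ) = 1 :=
    Matrix.map_one _ (by simp) (by simp)
  have hdet : IsUnit (1 - A).det := by
    rw [isUnit_iff_ne_zero]
    intro h0
    have : (Matrix.charpoly Ac).IsRoot 1 := by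
      rw [Polynomial.IsRoot, Matrix.eval_charpoly]
      have e : (Matrix.scalar (Fin n) (1:ℂ)) - Ac = (1 - A).map Complex.ofRealHom := by
        ext i j; simp [hAc, Matrix.one_apply]; split_ifs <;> simp
      rw [e, ← RingHom.mapMatrix_apply, ← RingHom.map_det, h0]; simp
    have := hA 1 this
    norm_num at this
  set C := (1 - A)⁻¹ with hC
  have hC1 : (1 - A) * C = 1 := Matrix.mul_nonsing_inv _ hdet
  have hC2 : C * (1 - A) = 1 := Matrix.nonsing_inv_mul _ hdet
  have hCt : (1 - A)ᵀ * Cᵀ = 1 := by rw [← Matrix.transpose_mul, hC2, Matrix.transpose_one]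
  set B := (1 + A) * C with hB
  have hBC : B * (1 - A) = 1 + A := by rw [hB, mul_assoc, hC2, mul_one]
  have hBCt : (1 - A)ᵀ * Bᵀ = (1 + A)ᵀ := by rw [← Matrix.transpose_mul, hBC]
  have hBs : ∀ μ ∈ spectrum ℂ (B.map ((↑) : ℝ → ℂ)), ‖μ‖ < 1 := by
    intro μ hμ
    set Bc := B.map ((↑) : ℝ → ℂ)
    set Cc := C.map ((↑) : ℝ → ℂ)
    have hm : (1 - A).map ((↑) : ℝ → ℂ) = 1 - Ac := by
      ext i j; simp [hAc, Matrix.one_apply]; split_ifs <;> simp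
    have hp : (1 + A).map ((↑) : ℝ → ℂ) = 1 + Ac := by
      ext i j; simp [hAc, Matrix.one_apply]; split_ifs <;> simp
    have k1 : (1 - Ac) * Cc = 1 := by rw [← hm, ← hmap, hC1, hone]
    have k2 : Cc * (1 - Ac) = 1 := by rw [← hm, ← hmap, hC2, hone]
    have k3 : Bc = (1 + Ac) * Cc := by rw [← hp, ← hmap]
    have uC : IsUnit Cc := ⟨⟨Cc, 1 - Ac, k2, k1⟩, rfl⟩
    have k4 : algebraMap ℂ _ μ - Bc = ((μ - 1) • (1 : Matrix (Fin n) (Fin n) ℂ) - (μ + 1) • Ac) * Cc := by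
      rw [k3, Algebra.algebraMap_eq_smul_one]
      nth_rewrite 1 [← k1]
      rw [← smul_mul_assoc, ← sub_mul]
      congr 1
      module
    rw [spectrum.mem_iff, k4] at hμ
    have hne : μ + 1 ≠ 0 := by
      intro h0
      apply hμ
      refine IsUnit.mul ?_ uC
      rw [h0, zero_smul, sub_zero, ← Algebra.algebraMap_eq_smul_one]
      refine (IsUnit.mk0 (μ - 1) ?_).map _
      intro h1
      have : (2:ℂ) = 0 := by linear_combination h0 - h1
      norm_num at this
    apply cayley_re
    apply hsp
    rw [spectrum.mem_iff]
    intro hu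
    apply hμ
    refine IsUnit.mul ?_ uC
    have : (μ - 1) • (1 : Matrix (Fin n) (Fin n) ℂ) - (μ + 1) • Ac
        = algebraMap ℂ _ (μ + 1) * (algebraMap ℂ _ ((μ - 1) / (μ + 1)) - Ac) := by
      rw [mul_sub, ← map_mul, mul_div_cancel₀ _ hne, Algebra.algebraMap_eq_smul_one,
        Algebra.algebraMap_eq_smul_one, smul_mul_assoc, one_mul]
    rw [this]
    exact ((IsUnit.mk0 _ hne).map _).mul hu
  obtain ⟨p, hp, hf⟩ := lyap_mat hn B (Cᵀ * Q * C) hBs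
  have hQt : Qᵀ = Q := by simpa using hQ.1.eq
  have hpt : pᵀ = p := by
    ext i j
    have h1 := hf (Matrix.entryLinearMap ℝ ℝ i j)
    have h2 := hf (Matrix.entryLinearMap ℝ ℝ j i)
    refine h2.unique ?_
    change HasSum _ (Matrix.entryLinearMap ℝ ℝ i j p)
    convert h1 using 2 with k
    have : (Bᵀ ^ k * (Cᵀ * Q * C) * B ^ k)ᵀ = Bᵀ ^ k * (Cᵀ * Q * C) * B ^ k := by
      simp [Matrix.transpose_mul, Matrix.transpose_pow, hQt, mul_assoc]
    exact congrFun (congrFun this i) j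
  have hquad : ∀ (x : Fin n → ℝ) (D : Matrix (Fin n) (Fin n) ℝ),
      x ⬝ᵥ ((Dᵀ * Q * D) *ᵥ x) = (D *ᵥ x) ⬝ᵥ (Q *ᵥ (D *ᵥ x)) := by
    intro x D
    rw [← Matrix.mulVec_mulVec, ← Matrix.mulVec_mulVec, Matrix.dotProduct_mulVec,
      Matrix.vecMul_transpose]
  have hpos : p.PosDef := by
    refine Matrix.PosDef.of_dotProduct_mulVec_pos (by simpa [Matrix.IsHermitian] using hpt) ?_
    intro x hx
    let f : Matrix (Fin n) (Fin n) ℝ →ₗ[ℝ] ℝ :=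
      { toFun := fun X => x ⬝ᵥ (X *ᵥ x)
        map_add' := fun X Y => by simp [Matrix.add_mulVec, dotProduct_add]
        map_smul' := fun c X => by simp [Matrix.smul_mulVec, dotProduct_smul] }
    have h1 := hf f
    have e : ∀ k, f (Bᵀ ^ k * (Cᵀ * Q * C) * B ^ k)
        = ((C * B ^ k) *ᵥ x) ⬝ᵥ (Q *ᵥ ((C * B ^ k) *ᵥ x)) := by
      intro k
      rw [← hquad]
      simp [f, Matrix.transpose_mul, Matrix.transpose_pow, mul_assoc]
    have h0 : 0 < f (Bᵀ ^ 0 * (Cᵀ * Q * C) * B ^ 0) := by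
      rw [e]
      have := hQ.dotProduct_mulVec_pos (x := (C * B ^ 0) *ᵥ x) ?_
      · simpa using this
      · intro hz
        apply hx
        rw [pow_zero, mul_one] at hz
        have := congrArg (fun v => (1 - A) *ᵥ v) hz
        simpa [Matrix.mulVec_mulVec, hC1] using this
    have h2 := le_hasSum h1 0 (fun k _ => by
      rw [e]
      simpa using hQ.posSemidef.dotProduct_mulVec_nonneg ((C * B ^ k) *ᵥ x))
    have : 0 < f p := h0.trans_le h2
    simpa [f] using this
  have key : (1 - A)ᵀ * p * (1 - A) - (1 + A)ᵀ * p * (1 + A) = Q := by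
    calc _ = (1 - A)ᵀ * (p - Bᵀ * p * B) * (1 - A) := by
          rw [← hBCt, ← hBC]; noncomm_ring
      _ = ((1 - A)ᵀ * Cᵀ) * Q * (C * (1 - A)) := by rw [hp]; simp only [mul_assoc]
      _ = Q := by rw [hCt, hC2, one_mul, mul_one]
  refine ⟨(2:ℝ) • p, hpos.smul (by norm_num), ?_⟩
  rw [← key, Matrix.transpose_sub, Matrix.transpose_add, Matrix.transpose_one, two_smul]
  noncomm_ring
end

section
/- Let c̃₁, c̃₂, r > 0 and k ≥ 0, and let t₀ = s₀ ≤ s₁ ≤ ⋯ ≤ s_{2k+1} = t be real numbers. Let W : ℝ → ℝ be continuous on [t₀, t], nonnegative on [t₀, t], and differentiable on each open subinterval (s_l, s_{l+1}), with W′(u) ≥ c̃₁(W(u) + r) for all u ∈ (s_{2l}, s_{2l+1}) (l = 0,…,k) and W′(u) ≥ −c̃₂ W(u) for all u ∈ (s_{2l+1}, s_{2l+2}) (l = 0,…,k−1). Set T_N = Σ_{l=0}^{k} (s_{2l+1} − s_{2l}) and T_D = Σ_{l=0}^{k−1} (s_{2l+2} − s_{2l+1}). Then W(t) ≥ (W(t₀)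 + r)·exp(c̃₁ T_N − c̃₂ T_D) − r. -/
/-- One-interval Gronwall lower bound. -/
lemma gron_step (c r a b : ℝ) (hab : a ≤ b) (W : ℝ → ℝ)
    (hc : ContinuousOn W (Set.Icc a b))
    (hd : ∀ u ∈ Set.Ioo a b, DifferentiableAt ℝ W u)
    (hd' : ∀ u ∈ Set.Ioo a b, c * (W u + r) ≤ deriv W u) :
    (W a + r) * Real.exp (c * (b - a)) ≤ W b + r := by
  have hder : ∀ u ∈ Set.Ioo a b, HasDerivAt (fun x => (W x + r) * Real.exp (-c * x))
      (deriv W u * Real.exp (-c * u) + (W u + r) * (Real.exp (-c * u) * (-c * 1))) u := by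
    intro u hu
    exact ((hd u hu).hasDerivAt.add_const r).mul (((hasDerivAt_id u).const_mul (-c)).exp)
  have hm : MonotoneOn (fun x => (W x + r) * Real.exp (-c * x)) (Set.Icc a b) := by
    apply monotoneOn_of_deriv_nonneg (convex_Icc a b)
    · exact (hc.add continuousOn_const).mul (by fun_prop)
    · rw [interior_Icc]
      intro u hu
      exact (hder u hu).differentiableAt.differentiableWithinAt
    · rw [interior_Icc]
      intro u hu
      rw [(hder u hu).deriv]
      have := mul_nonneg (sub_nonneg.2 (hd' u hu)) (Real.exp_pos (-c * u)).le
      linarith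
  have h := hm (Set.left_mem_Icc.2 hab) (Set.right_mem_Icc.2 hab) hab
  have h2 := mul_le_mul_of_nonneg_right h (Real.exp_pos (c * b)).le
  simp only [mul_assoc, ← Real.exp_add] at h2
  rw [show -c * a + c * b = c * (b - a) by ring, show -c * b + c * b = 0 by ring,
    Real.exp_zero, mul_one] at h2
  exact h2

/-- lower bound on a function `W` that grows at rate at least
`c̃₁ (W + r)` on attack-free intervals `(s_{2l}, s_{2l+1})` and decays at rate at
most `c̃₂ W` on attack intervals `(s_{2l+1}, s_{2l+2})`:
`W(t) ≥ (W(t₀) + r) exp(c̃₁ T_N - c̃₂ T_D) - r`. -/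
theorem stmt_18 (tc₁ tc₂ r : ℝ) (h₁ : 0 < tc₁) (h₂ : 0 < tc₂) (hr : 0 < r)
    (k : ℕ) (s : ℕ → ℝ) (t₀ t : ℝ)
    (hs0 : s 0 = t₀) (hslast : s (2 * k + 1) = t)
    (hmono : ∀ l, l < 2 * k + 1 → s l ≤ s (l + 1))
    (W : ℝ → ℝ)
    (hW_cont : ContinuousOn W (Set.Icc t₀ t))
    (hW_nonneg : ∀ u ∈ Set.Icc t₀ t, 0 ≤ W u)
    (hdiffN : ∀ l, l ≤ k → ∀ u ∈ Set.Ioo (s (2 * l)) (s (2 * l + 1)),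
      DifferentiableAt ℝ W u)
    (hderivN : ∀ l, l ≤ k → ∀ u ∈ Set.Ioo (s (2 * l)) (s (2 * l + 1)),
      tc₁ * (W u + r) ≤ deriv W u)
    (hdiffD : ∀ l, l < k → ∀ u ∈ Set.Ioo (s (2 * l + 1)) (s (2 * l + 2)),
      DifferentiableAt ℝ W u)
    (hderivD : ∀ l, l < k → ∀ u ∈ Set.Ioo (s (2 * l + 1)) (s (2 * l + 2)),
      -tc₂ * W u ≤ deriv W u) :
    (W t₀ + r) *
        Real.exp (tc₁ * (∑ l ∈ Finset.range (k + 1), (s (2 * l + 1) - s (2 * l)))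
          - tc₂ * (∑ l ∈ Finset.range k, (s (2 * l + 2) - s (2 * l + 1)))) - r ≤ W t := by
  have hmon : ∀ i j, i ≤ j → j ≤ 2 * k + 1 → s i ≤ s j := by
    intro i j hij
    induction j, hij using Nat.le_induction with
    | base => intro _; exact le_rfl
    | succ n hn ih =>
      intro h
      exact (ih (by omega)).trans (hmono n (by omega))
  have hsub : ∀ i j, i ≤ j → j ≤ 2 * k + 1 → Set.Icc (s i) (s j) ⊆ Set.Icc t₀ t := by
    intro i j hij hj
    rw [← hs0, ← hslast]
    exact Set.Icc_subset_Icc (hmon 0 i (by omega) (by omega)) (hmon j _ hj le_rfl)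
  have hN : ∀ l, l ≤ k → (W (s (2 * l)) + r) * Real.exp (tc₁ * (s (2 * l + 1) - s (2 * l)))
      ≤ W (s (2 * l + 1)) + r := fun l hl =>
    gron_step tc₁ r _ _ (hmono _ (by omega)) W
      (hW_cont.mono (hsub _ _ (by omega) (by omega))) (hdiffN l hl) (hderivN l hl)
  have hD : ∀ l, l < k →
      (W (s (2 * l + 1)) + r) * Real.exp (-tc₂ * (s (2 * l + 2) - s (2 * l + 1)))
      ≤ W (s (2 * l + 2)) + r := fun l hl =>
    gron_step (-tc₂) r _ _ (hmono _ (by omega)) W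
      (hW_cont.mono (hsub _ _ (by omega) (by omega))) (hdiffD l hl) (fun u hu => by
        have := hderivD l hl u hu
        have := mul_pos h₂ hr
        linarith)
  have key : ∀ j, j ≤ k → (W t₀ + r) *
        Real.exp (tc₁ * (∑ l ∈ Finset.range (j + 1), (s (2 * l + 1) - s (2 * l)))
          - tc₂ * (∑ l ∈ Finset.range j, (s (2 * l + 2) - s (2 * l + 1))))
        ≤ W (s (2 * j + 1)) + r := by
    intro j
    induction j with
    | zero =>
      intro _
      have := hN 0 (Nat.zero_le k)
      simpa [hs0] using this
    | succ n ih =>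
      intro hn
      have e1 := ih (by omega)
      have e2 := hD n (by omega)
      have e3 := hN (n + 1) hn
      have e4 := (mul_le_mul_of_nonneg_right e1 (Real.exp_pos
        (-tc₂ * (s (2 * n + 2) - s (2 * n + 1)))).le).trans e2
      have e5 := (mul_le_mul_of_nonneg_right e4 (Real.exp_pos
        (tc₁ * (s (2 * (n + 1) + 1) - s (2 * (n + 1))))).le).trans e3
      refine le_trans (le_of_eq ?_) e5
      rw [mul_assoc, mul_assoc, ← Real.exp_add, ← Real.exp_add,
        Finset.sum_range_succ _ (n + 1), Finset.sum_range_succ _ n]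
      rw [Finset.sum_range_succ (fun l => s (2 * l + 2) - s (2 * l + 1)) n]
      congr 2
      ring
  have := key k le_rfl
  rw [hslast] at this
  linarith
end

section
/- Let ĉ₁, ĉ₂ > 0 and k ≥ 0, and let t̄₀ = s₀ ≤ s₁ ≤ ⋯ ≤ s_{2k+1} = t be real numbers. Let W : ℝ → ℝ be continuous on [t̄₀, t] and differentiable on each open subinterval (s_l, s_{l+1}), with W′(u) ≤ −ĉ₁ for all u ∈ (s_{2l}, s_{2l+1}) (l = 0,…,k) and W′(u) ≤ ĉ₂ W(u) for all u ∈ (s_{2l+1}, s_{2l+2}) (l = 0,…,k−1). Set T_N = Σ_{l=0}^{k} (s_{2l+1} − s_{2l}) and T_D = Σ_{l=0}^{k−1} (s_{2l+2} − s_{2l+1}). Then W(t) ≤ W(t̄₀)·exp(ĉ₂ T_D) − ĉ₁ T_N; in particular, if W(t̄₀) ≤ 1 then W(t) ≤ exp(ĉ₂ T_D) − ĉ₁ T_N. -/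
theorem aux_N (W : ℝ → ℝ) (a b c : ℝ) (hab : a ≤ b) (hc : ContinuousOn W (Set.Icc a b))
    (hd : ∀ u ∈ Set.Ioo a b, DifferentiableAt ℝ W u)
    (hd' : ∀ u ∈ Set.Ioo a b, deriv W u ≤ -c) : W b ≤ W a - c * (b - a) := by
  have h := Convex.image_sub_le_mul_sub_of_deriv_le (convex_Icc a b) hc
    (by rw [interior_Icc]; exact fun u hu => (hd u hu).differentiableWithinAt)
    (C := -c) (by rw [interior_Icc]; exact hd') a (Set.left_mem_Icc.2 hab) b
    (Set.right_mem_Icc.2 hab) hab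
  linarith

theorem aux_D (W : ℝ → ℝ) (a b c : ℝ) (hab : a ≤ b) (hc : ContinuousOn W (Set.Icc a b))
    (hd : ∀ u ∈ Set.Ioo a b, DifferentiableAt ℝ W u)
    (hd' : ∀ u ∈ Set.Ioo a b, deriv W u ≤ c * W u) :
    W b ≤ W a * Real.exp (c * (b - a)) := by
  have hD : ∀ u ∈ Set.Ioo a b, HasDerivAt (fun u => W u * Real.exp (c * (b - u)))
      (deriv W u * Real.exp (c * (b - u)) + W u * (Real.exp (c * (b - u)) * (c * (-1)))) u := by
    intro u hu
    exact (hd u hu).hasDerivAt.mul ((((hasDerivAt_id u).const_sub b).const_mul c).exp)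
  have h : AntitoneOn (fun u => W u * Real.exp (c * (b - u))) (Set.Icc a b) := by
    apply antitoneOn_of_deriv_nonpos (convex_Icc a b)
    · exact hc.mul (by fun_prop)
    · rw [interior_Icc]
      exact fun u hu => (hD u hu).differentiableAt.differentiableWithinAt
    · rw [interior_Icc]
      intro u hu
      rw [(hD u hu).deriv]
      nlinarith [mul_le_mul_of_nonneg_right (hd' u hu) (Real.exp_pos (c * (b - u))).le]
  have := h (Set.left_mem_Icc.2 hab) (Set.right_mem_Icc.2 hab) hab
  simpa using this

/-- upper bound on a function `W` that decreases at rate at least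
`ĉ₁` on attack-free intervals `(s_{2l}, s_{2l+1})` and grows at rate at most
`ĉ₂ W` on attack intervals `(s_{2l+1}, s_{2l+2})`:
`W(t) ≤ W(t̄₀) exp(ĉ₂ T_D) - ĉ₁ T_N`; in particular, if `W(t̄₀) ≤ 1` then
`W(t) ≤ exp(ĉ₂ T_D) - ĉ₁ T_N`. -/
theorem stmt_19 (hc₁ hc₂ : ℝ) (h₁ : 0 < hc₁) (h₂ : 0 < hc₂)
    (k : ℕ) (s : ℕ → ℝ) (tb₀ t : ℝ)
    (hs0 : s 0 = tb₀) (hslast : s (2 * k + 1) = t)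
    (hmono : ∀ l, l < 2 * k + 1 → s l ≤ s (l + 1))
    (W : ℝ → ℝ)
    (hW_cont : ContinuousOn W (Set.Icc tb₀ t))
    (hdiffN : ∀ l, l ≤ k → ∀ u ∈ Set.Ioo (s (2 * l)) (s (2 * l + 1)),
      DifferentiableAt ℝ W u)
    (hderivN : ∀ l, l ≤ k → ∀ u ∈ Set.Ioo (s (2 * l)) (s (2 * l + 1)),
      deriv W u ≤ -hc₁)
    (hdiffD : ∀ l, l < k → ∀ u ∈ Set.Ioo (s (2 * l + 1)) (s (2 * l + 2)),
      DifferentiableAt ℝ W u)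
    (hderivD : ∀ l, l < k → ∀ u ∈ Set.Ioo (s (2 * l + 1)) (s (2 * l + 2)),
      deriv W u ≤ hc₂ * W u) :
    W t ≤ W tb₀ *
        Real.exp (hc₂ * (∑ l ∈ Finset.range k, (s (2 * l + 2) - s (2 * l + 1))))
        - hc₁ * (∑ l ∈ Finset.range (k + 1), (s (2 * l + 1) - s (2 * l))) ∧
      (W tb₀ ≤ 1 → W t ≤
        Real.exp (hc₂ * (∑ l ∈ Finset.range k, (s (2 * l + 2) - s (2 * l + 1))))
          - hc₁ * (∑ l ∈ Finset.range (k + 1), (s (2 * l + 1) - s (2 * l)))) := by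
  have hm : ∀ j, j ≤ 2 * k + 1 → ∀ i, i ≤ j → s i ≤ s j := by
    intro j
    induction j with
    | zero => intro _ i hi; rw [Nat.le_zero.1 hi]
    | succ j ih =>
      intro hj i hi
      rcases Nat.lt_or_ge i (j + 1) with h | h
      · exact (ih (by omega) i (by omega)).trans (hmono j (by omega))
      · rw [le_antisymm hi h]
  have hcont : ∀ i, i < 2 * k + 1 → ContinuousOn W (Set.Icc (s i) (s (i + 1))) := by
    intro i hi
    apply hW_cont.mono
    apply Set.Icc_subset_Icc
    · rw [← hs0]; exact hm i (by omega) 0 (by omega)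
    · rw [← hslast]; exact hm (2 * k + 1) le_rfl (i + 1) (by omega)
  have hN : ∀ l, l ≤ k → W (s (2 * l + 1)) ≤ W (s (2 * l)) - hc₁ * (s (2 * l + 1) - s (2 * l)) :=
    fun l hl => aux_N W _ _ _ (hmono _ (by omega)) (hcont _ (by omega)) (hdiffN l hl) (hderivN l hl)
  have hD : ∀ l, l < k → W (s (2 * l + 2)) ≤
      W (s (2 * l + 1)) * Real.exp (hc₂ * (s (2 * l + 2) - s (2 * l + 1))) :=
    fun l hl => aux_D W _ _ _ (hmono (2 * l + 1) (by omega)) (hcont (2 * l + 1) (by omega))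
      (hdiffD l hl) (hderivD l hl)
  have main : ∀ j, j ≤ k → W (s (2 * j + 1)) ≤ W tb₀ *
        Real.exp (hc₂ * (∑ l ∈ Finset.range j, (s (2 * l + 2) - s (2 * l + 1))))
        - hc₁ * (∑ l ∈ Finset.range (j + 1), (s (2 * l + 1) - s (2 * l))) := by
    intro j
    induction j with
    | zero =>
      intro h
      have := hN 0 h
      simpa [hs0] using this
    | succ j ih =>
      intro hj
      have i1 := ih (by omega)
      have i2 := hD j (by omega)
      have i3 := hN (j + 1) hj
      rw [Finset.sum_range_succ _ (j + 1), Finset.sum_range_succ _ j, mul_add hc₂, Real.exp_add]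
      have e1 : 1 ≤ Real.exp (hc₂ * (s (2 * j + 2) - s (2 * j + 1))) := by
        apply Real.one_le_exp
        exact mul_nonneg h₂.le (sub_nonneg.2 (hmono (2 * j + 1) (by omega)))
      have hT : 0 ≤ ∑ l ∈ Finset.range (j + 1), (s (2 * l + 1) - s (2 * l)) := by
        apply Finset.sum_nonneg
        intro l hl
        have := Finset.mem_range.1 hl
        exact sub_nonneg.2 (hmono _ (by omega))
      have i4 := mul_le_mul_of_nonneg_right i1 (zero_le_one.trans e1)
      have i5 := mul_le_mul_of_nonneg_left e1 (mul_nonneg h₁.le hT)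
      have e2 : 2 * (j + 1) = 2 * j + 2 := by ring
      simp only [e2] at i3 ⊢
      linarith
  have hk := main k le_rfl
  rw [hslast] at hk
  refine ⟨hk, fun hW => hk.trans ?_⟩
  have := mul_le_mul_of_nonneg_right hW (Real.exp_pos
    (hc₂ * (∑ l ∈ Finset.range k, (s (2 * l + 2) - s (2 * l + 1))))).le
  linarith
end
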